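/- Let A ⊆ C be an inclusion of C*-algebras such that A is σ-unital and AC is dense in C, and let A^s = A⊗K ⊆ C^s = C⊗K be the induced inclusion, where K is the C*-algebra of compact operators on a countably infinite dimensional Hilbert space. Then the sequence 1 → Int(A^s, C^s) → Aut(A^s, C^s) → Pic(A^s, C^s) → 1 is exact; in particular the homomorphism π: Aut(A^s,C^s) → Pic(A^s,C^s), π(α) = [X_α, Y_α], is surjective with kernel Int(A^s,C^s). -/

import Mathlib

open scoped MultiplierAlgebra

noncomputable section

structure EquivBimodule (C D Y : Type*)
    [NonUnitalCStarAlgebra C] [PartialOrder C] [StarOrderedRing C]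
    [NonUnitalCStarAlgebra D] [PartialOrder D] [StarOrderedRing D]
    [NormedAddCommGroup Y] [NormedSpace ℂ Y] [CompleteSpace Y] : Type _ where
  lsmul : C → Y → Y
  rsmul : Y → D → Y
  linn : Y → Y → C
  rinn : Y → Y → D
  lsmul_add : ∀ c x y, lsmul c (x + y) = lsmul c x + lsmul c y
  add_lsmul : ∀ c c' x, lsmul (c + c') x = lsmul c x + lsmul c' x
  mul_lsmul : ∀ c c' x, lsmul (c * c') x = lsmul c (lsmul c' x)
  smul_lsmul : ∀ (z : ℂ) c x, lsmul (z • c) x = z • lsmul c x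
  lsmul_smul : ∀ (z : ℂ) c x, lsmul c (z • x) = z • lsmul c x
  add_rsmul : ∀ x y d, rsmul (x + y) d = rsmul x d + rsmul y d
  rsmul_add : ∀ x d d', rsmul x (d + d') = rsmul x d + rsmul x d'
  rsmul_mul : ∀ x d d', rsmul x (d * d') = rsmul (rsmul x d) d'
  rsmul_smul : ∀ (z : ℂ) x d, rsmul (z • x) d = z • rsmul x d
  smul_rsmul : ∀ (z : ℂ) x d, rsmul x (z • d) = z • rsmul x d
  lsmul_rsmul : ∀ c x d, rsmul (lsmul c x) d = lsmul c (rsmul x d)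
  linn_add_left : ∀ x y z, linn (x + y) z = linn x z + linn y z
  linn_smul_left : ∀ (t : ℂ) x y, linn (t • x) y = t • linn x y
  linn_star : ∀ x y, star (linn x y) = linn y x
  linn_lsmul_left : ∀ c x y, linn (lsmul c x) y = c * linn x y
  linn_nonneg : ∀ x, 0 ≤ linn x x
  linn_definite : ∀ x, linn x x = 0 → x = 0
  rinn_add_right : ∀ x y z, rinn x (y + z) = rinn x y + rinn x z
  rinn_smul_right : ∀ (t : ℂ) x y, rinn x (t • y) = t • rinn x y
  rinn_star : ∀ x y, star (rinn x y) = rinn y x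
  rinn_rsmul_right : ∀ x y d, rinn x (rsmul y d) = rinn x y * d
  rinn_nonneg : ∀ x, 0 ≤ rinn x x
  rinn_definite : ∀ x, rinn x x = 0 → x = 0
  imprimitivity : ∀ x y z, lsmul (linn x y) z = rsmul x (rinn y z)
  norm_linn : ∀ x, ‖linn x x‖ = ‖x‖ ^ 2
  norm_rinn : ∀ x, ‖rinn x x‖ = ‖x‖ ^ 2
  full_left : Dense (Submodule.span ℂ {c : C | ∃ x y, c = linn x y} : Set C)
  full_right : Dense (Submodule.span ℂ {d : D | ∃ x y, d = rinn x y} : Set D)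

namespace EquivBimodule

variable {C D Y W : Type*}
    [NonUnitalCStarAlgebra C] [PartialOrder C] [StarOrderedRing C]
    [NonUnitalCStarAlgebra D] [PartialOrder D] [StarOrderedRing D]
    [NormedAddCommGroup Y] [NormedSpace ℂ Y] [CompleteSpace Y]
    [NormedAddCommGroup W] [NormedSpace ℂ W] [CompleteSpace W]

structure Iso (E : EquivBimodule C D Y) (F : EquivBimodule C D W) where
  toEquiv : Y ≃ₗ[ℂ] W
  map_lsmul : ∀ c y, toEquiv (E.lsmul c y) = F.lsmul c (toEquiv y)
  map_rsmul : ∀ y d, toEquiv (E.rsmul y d) = F.rsmul (toEquiv y) d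
  map_linn : ∀ x y, F.linn (toEquiv x) (toEquiv y) = E.linn x y
  map_rinn : ∀ x y, F.rinn (toEquiv x) (toEquiv y) = E.rinn x y

end EquivBimodule

def DenseIncl {A C : Type*} [NonUnitalCStarAlgebra C] (ι : A → C) : Prop :=
  Dense (Submodule.span ℂ {x : C | ∃ (a : A) (c : C), x = ι a * c} : Set C)

structure IsMoritaIncl {A B C D Y : Type*}
    [NonUnitalCStarAlgebra C] [PartialOrder C] [StarOrderedRing C]
    [NonUnitalCStarAlgebra D] [PartialOrder D] [StarOrderedRing D]
    [NormedAddCommGroup Y] [NormedSpace ℂ Y] [CompleteSpace Y]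
    (ιA : A → C) (ιB : B → D)
    (E : EquivBimodule C D Y) (X : Submodule ℂ Y) : Prop where
  closed : IsClosed (X : Set Y)
  lsmul_mem : ∀ (a : A), ∀ x ∈ X, E.lsmul (ιA a) x ∈ X
  rsmul_mem : ∀ (b : B), ∀ x ∈ X, E.rsmul x (ιB b) ∈ X
  linn_mem : ∀ x ∈ X, ∀ y ∈ X, E.linn x y ∈ Set.range ιA
  rinn_mem : ∀ x ∈ X, ∀ y ∈ X, E.rinn x y ∈ Set.range ιB
  span_XX_left :
    closure (Submodule.span ℂ {c : C | ∃ x ∈ X, ∃ y ∈ X, c = E.linn x y} : Set C) = Set.range ιA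
  span_YX_left :
    Dense (Submodule.span ℂ {c : C | ∃ (y : Y), ∃ x ∈ X, c = E.linn y x} : Set C)
  span_XX_right :
    closure (Submodule.span ℂ {d : D | ∃ x ∈ X, ∃ y ∈ X, d = E.rinn x y} : Set D) = Set.range ιB
  span_YX_right :
    Dense (Submodule.span ℂ {d : D | ∃ (y : Y), ∃ x ∈ X, d = E.rinn y x} : Set D)

abbrev IsEquiPair {A C Y : Type*}
    [NonUnitalCStarAlgebra C] [PartialOrder C] [StarOrderedRing C]
    [NormedAddCommGroup Y] [NormedSpace ℂ Y] [CompleteSpace Y]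
    (ι : A → C) (E : EquivBimodule C C Y) (X : Submodule ℂ Y) : Prop :=
  IsMoritaIncl ι ι E X

def PairEquiv {C D Y W : Type*}
    [NonUnitalCStarAlgebra C] [PartialOrder C] [StarOrderedRing C]
    [NonUnitalCStarAlgebra D] [PartialOrder D] [StarOrderedRing D]
    [NormedAddCommGroup Y] [NormedSpace ℂ Y] [CompleteSpace Y]
    [NormedAddCommGroup W] [NormedSpace ℂ W] [CompleteSpace W]
    (E : EquivBimodule C D Y) (X : Submodule ℂ Y)
    (F : EquivBimodule C D W) (Z : Submodule ℂ W) : Prop :=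
  ∃ Φ : E.Iso F, X.map Φ.toEquiv.toLinearMap = Z

def IsTrivialData {C : Type*}
    [NonUnitalCStarAlgebra C] [PartialOrder C] [StarOrderedRing C]
    (T : EquivBimodule C C C) : Prop :=
  T.lsmul = (fun c x => c * x) ∧ T.rsmul = (fun x c => x * c) ∧
    T.linn = (fun x y => x * star y) ∧ T.rinn = (fun x y => star x * y)

/-- The data of the equivalence bimodule `Y_σ` induced by an automorphism with
underlying map `σ` (with inverse `σinv`). -/
def IsAlphaData {C : Type*}
    [NonUnitalCStarAlgebra C] [PartialOrder C] [StarOrderedRing C]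
    (σ σinv : C → C) (T : EquivBimodule C C C) : Prop :=
  T.lsmul = (fun c x => c * x) ∧ T.rsmul = (fun x c => x * σ c) ∧
    T.linn = (fun x y => x * star y) ∧ T.rinn = (fun x y => σinv (star x * y))

/-- The submodule `{ι a | a : A}` of `C`, e.g. the subspace `X_α = A` of `Y_α = C`. -/
def rangeSub {A C : Type*} [NonUnitalCStarAlgebra C]
    (ι : A → C) : Submodule ℂ C :=
  Submodule.span ℂ (Set.range ι)

/-- A realization of the interior tensor product `Y ⊗_D W` of equivalence bimodules. -/
structure IsTensorProd {C D L Y W V : Type*}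
    [NonUnitalCStarAlgebra C] [PartialOrder C] [StarOrderedRing C]
    [NonUnitalCStarAlgebra D] [PartialOrder D] [StarOrderedRing D]
    [NonUnitalCStarAlgebra L] [PartialOrder L] [StarOrderedRing L]
    [NormedAddCommGroup Y] [NormedSpace ℂ Y] [CompleteSpace Y]
    [NormedAddCommGroup W] [NormedSpace ℂ W] [CompleteSpace W]
    [NormedAddCommGroup V] [NormedSpace ℂ V] [CompleteSpace V]
    (E : EquivBimodule C D Y) (G : EquivBimodule D L W)
    (F : EquivBimodule C L V) (s : Y → W → V) : Prop where
  add_left : ∀ y y' w, s (y + y') w = s y w + s y' w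
  smul_left : ∀ (z : ℂ) y w, s (z • y) w = z • s y w
  add_right : ∀ y w w', s y (w + w') = s y w + s y w'
  smul_right : ∀ (z : ℂ) y w, s y (z • w) = z • s y w
  balanced : ∀ y d w, s (E.rsmul y d) w = s y (G.lsmul d w)
  map_lsmul : ∀ c y w, F.lsmul c (s y w) = s (E.lsmul c y) w
  map_rsmul : ∀ y w l, F.rsmul (s y w) l = s y (G.rsmul w l)
  map_linn : ∀ y y' w w',
    F.linn (s y w) (s y' w') = E.linn (E.rsmul y (G.linn w w')) y'
  map_rinn : ∀ y y' w w',
    F.rinn (s y w) (s y' w') = G.rinn w (G.lsmul (E.rinn y y') w')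
  dense : Dense (Submodule.span ℂ {v : V | ∃ y w, v = s y w} : Set V)

/-- A realization of the product of two elements of `Equi(A, C)`:
the tensor product bimodule together with the distinguished subspace `X₁ ⊗ X₂`. -/
structure IsPairTensor {A C Y W V : Type*}
    [NonUnitalCStarAlgebra C] [PartialOrder C] [StarOrderedRing C]
    [NormedAddCommGroup Y] [NormedSpace ℂ Y] [CompleteSpace Y]
    [NormedAddCommGroup W] [NormedSpace ℂ W] [CompleteSpace W]
    [NormedAddCommGroup V] [NormedSpace ℂ V] [CompleteSpace V]
    (ι : A → C)
    (E₁ : EquivBimodule C C Y) (X₁ : Submodule ℂ Y)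
    (E₂ : EquivBimodule C C W) (X₂ : Submodule ℂ W)
    (G : EquivBimodule C C V) (XV : Submodule ℂ V) (s : Y → W → V) : Prop where
  tensor : IsTensorProd E₁ E₂ G s
  sub : (XV : Set V) =
    closure (Submodule.span ℂ {v : V | ∃ x ∈ X₁, ∃ z ∈ X₂, v = s x z} : Set V)

section Multiplier

variable {C : Type*} [NonUnitalCStarAlgebra C]

/-- Conjugation `c ↦ u c u*` by a (unitary) multiplier `u ∈ M(C)`. -/
def mAd (u : 𝓜(ℂ, C)) (c : C) : C := u.fst ((star u).snd c)

/-- `m ∈ M(C)` is (the extension of) a multiplier of the subalgebra `A` (realized by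
`ι : A → C`): it maps `A` into `A` on both sides.  When `AC` is dense in `C`, the
multiplier algebra `M(A)` is exactly the set of such multipliers. -/
def IsMultiplierOf {A : Type*} (ι : A → C) (m : 𝓜(ℂ, C)) : Prop :=
  (∀ a : A, m.fst (ι a) ∈ Set.range ι) ∧ (∀ a : A, m.snd (ι a) ∈ Set.range ι)

/-- `u ∈ K(M(C))`: a unitary multiplier with `u a u*, u* a u ∈ A` for all `a ∈ A`. -/
def mem_KMC {A : Type*} (ι : A → C) (u : 𝓜(ℂ, C)) : Prop :=
  u ∈ unitary 𝓜(ℂ, C) ∧ (∀ a : A, mAd u (ι a) ∈ Set.range ι) ∧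
    (∀ a : A, mAd (star u) (ι a) ∈ Set.range ι)

/-- The subspace `Au = {a u | a ∈ A}` of `C`, for a multiplier `u ∈ M(C)`. -/
def AuSub {A : Type*} (ι : A → C) (u : 𝓜(ℂ, C)) : Submodule ℂ C :=
  Submodule.span ℂ {x : C | ∃ a : A, x = u.snd (ι a)}

end Multiplier

/-- A positive element `h` with `hA` dense in `A`; a C*-algebra is σ-unital iff it
possesses such a (strictly positive) element. -/
def SigmaUnital (A : Type*) [NonUnitalCStarAlgebra A] [PartialOrder A]
    [StarOrderedRing A] : Prop :=
  ∃ h : A, 0 ≤ h ∧ Dense (Set.range fun a : A => h * a)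

/-- A system of matrix units over `C` realizing `Cs` as the stabilization `C ⊗ K`. -/
structure IsStabilization {C Cs : Type*} [NonUnitalCStarAlgebra C]
    [NonUnitalCStarAlgebra Cs] (e : ℕ → ℕ → C → Cs) : Prop where
  map_add : ∀ i j c c', e i j (c + c') = e i j c + e i j c'
  map_smul : ∀ i j (z : ℂ) c, e i j (z • c) = z • e i j c
  map_mul : ∀ i j k l c d, e i j c * e k l d = if j = k then e i l (c * d) else 0
  map_star : ∀ i j c, star (e i j c) = e j i (star c)
  isometry : ∀ i j c, ‖e i j c‖ = ‖c‖
  dense : Dense (Submodule.span ℂ {x : Cs | ∃ i j c, x = e i j c} : Set Cs)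

section Unital

variable {A B C D : Type*} [CStarAlgebra A] [CStarAlgebra B] [CStarAlgebra C] [CStarAlgebra D]
  [PartialOrder C] [StarOrderedRing C] [PartialOrder D] [StarOrderedRing D]

/-- A conditional expectation from `C` onto `A`, for a unital inclusion realized by
`ι : A →⋆ₐ[ℂ] C`. -/
structure CondExpectation [PartialOrder A] [StarOrderedRing A] (ι : A →⋆ₐ[ℂ] C) where
  toFun : C → A
  map_add : ∀ x y, toFun (x + y) = toFun x + toFun y
  map_smul : ∀ (z : ℂ) x, toFun (z • x) = z • toFun x
  map_star : ∀ x, toFun (star x) = star (toFun x)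
  retraction : ∀ a, toFun (ι a) = a
  left_mod : ∀ a c, toFun (ι a * c) = a * toFun c
  right_mod : ∀ c a, toFun (c * ι a) = toFun c * a
  pos : ∀ c, 0 ≤ toFun (star c * c)

/-- A quasi-basis for a conditional expectation, in the sense of Watatani. -/
def IsQuasiBasis [PartialOrder A] [StarOrderedRing A] {ι : A →⋆ₐ[ℂ] C}
    (E : CondExpectation ι) {n : ℕ} (u : Fin n → C) : Prop :=
  ∀ c : C, (∑ i, u i * ι (E.toFun (star (u i) * c)) = c) ∧
    (∑ i, ι (E.toFun (c * u i)) * star (u i) = c)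

/-- A conditional expectation is of Watatani index-finite type if it admits a
quasi-basis. -/
def FiniteIndex [PartialOrder A] [StarOrderedRing A] {ι : A →⋆ₐ[ℂ] C}
    (E : CondExpectation ι) : Prop :=
  ∃ (n : ℕ) (u : Fin n → C), IsQuasiBasis E u

/-- `A' ∩ C = ℂ 1` for the inclusion realized by `ι`. -/
def IrreducibleIncl (ι : A →⋆ₐ[ℂ] C) : Prop :=
  ∀ c : C, (∀ a : A, ι a * c = c * ι a) → ∃ z : ℂ, c = z • (1 : C)

variable [PartialOrder A] [StarOrderedRing A] [PartialOrder B] [StarOrderedRing B]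

/-- A conditional expectation `E^X : Y → X` with respect to `E^A` and `E^B`
(Definition 2.4 of [KT4]). -/
structure IsBimodCondExp {Y : Type*}
    [NormedAddCommGroup Y] [NormedSpace ℂ Y] [CompleteSpace Y]
    (ιA : A →⋆ₐ[ℂ] C) (ιB : B →⋆ₐ[ℂ] D)
    (EA : CondExpectation ιA) (EB : CondExpectation ιB)
    (EY : EquivBimodule C D Y) (X : Submodule ℂ Y) (EX : Y → Y) : Prop where
  map_add : ∀ y y', EX (y + y') = EX y + EX y'
  map_smul : ∀ (z : ℂ) y, EX (z • y) = z • EX y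
  mem : ∀ y, EX y ∈ X
  cond1 : ∀ (c : C), ∀ x ∈ X, EX (EY.lsmul c x) = EY.lsmul (ιA (EA.toFun c)) x
  cond2 : ∀ (a : A) (y : Y), EX (EY.lsmul (ιA a) y) = EY.lsmul (ιA a) (EX y)
  cond3 : ∀ (y : Y), ∀ x ∈ X, ιA (EA.toFun (EY.linn y x)) = EY.linn (EX y) x
  cond4 : ∀ (d : D), ∀ x ∈ X, EX (EY.rsmul x d) = EY.rsmul x (ιB (EB.toFun d))
  cond5 : ∀ (b : B) (y : Y), EX (EY.rsmul y (ιB b)) = EY.rsmul (EX y) (ιB b)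
  cond6 : ∀ (y : Y), ∀ x ∈ X, ιB (EB.toFun (EY.rinn y x)) = EY.rinn (EX y) x

/-- The C*-basic construction `C₁` for a conditional expectation `E : C → A`,
realized by a unital embedding `ιC : C →⋆ₐ[ℂ] C₁` and the Jones projection `e`. -/
structure IsBasicConstruction {A C C₁ : Type*} [CStarAlgebra A] [CStarAlgebra C]
    [CStarAlgebra C₁] [PartialOrder A] [StarOrderedRing A]
    [PartialOrder C] [StarOrderedRing C]
    (ι : A →⋆ₐ[ℂ] C) (E : CondExpectation ι)
    (ιC : C →⋆ₐ[ℂ] C₁) (e : C₁) : Prop where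
  inj : Function.Injective ιC
  idem : e * e = e
  selfadj : star e = e
  comm : ∀ a : A, ιC (ι a) * e = e * ιC (ι a)
  expect : ∀ c : C, e * ιC c * e = ιC (ι (E.toFun c)) * e
  faithful : ∀ c : C, ιC c * e = 0 → c = 0
  span : ∀ x : C₁, x ∈ Submodule.span ℂ {z : C₁ | ∃ c d : C, z = ιC c * e * ιC d}

end Unital

/-- `M` is the `A–B`-equivalence bimodule obtained by restricting the operations of the
`C–D`-equivalence bimodule `EY` to the closed subspace `X` (whose inner products on `X`
take values in the subalgebras realized by `ιA`, `ιB`). -/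
structure IsRestriction {A B C D Y : Type*}
    [NonUnitalCStarAlgebra A] [PartialOrder A] [StarOrderedRing A]
    [NonUnitalCStarAlgebra B] [PartialOrder B] [StarOrderedRing B]
    [NonUnitalCStarAlgebra C] [PartialOrder C] [StarOrderedRing C]
    [NonUnitalCStarAlgebra D] [PartialOrder D] [StarOrderedRing D]
    [NormedAddCommGroup Y] [NormedSpace ℂ Y] [CompleteSpace Y]
    (ιA : A → C) (ιB : B → D)
    (EY : EquivBimodule C D Y) (X : Submodule ℂ Y) [CompleteSpace X]
    (M : EquivBimodule A B X) : Prop where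
  lsmul_coe : ∀ (a : A) (x : X), (M.lsmul a x : Y) = EY.lsmul (ιA a) (x : Y)
  rsmul_coe : ∀ (x : X) (b : B), (M.rsmul x b : Y) = EY.rsmul (x : Y) (ιB b)
  linn_coe : ∀ x y : X, ιA (M.linn x y) = EY.linn (x : Y) (y : Y)
  rinn_coe : ∀ x y : X, ιB (M.rinn x y) = EY.rinn (x : Y) (y : Y)

section Upward

variable {A B C D C₁ D₁ : Type*} [CStarAlgebra A] [CStarAlgebra B] [CStarAlgebra C]
  [CStarAlgebra D] [CStarAlgebra C₁] [CStarAlgebra D₁]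
  [PartialOrder A] [StarOrderedRing A] [PartialOrder B] [StarOrderedRing B]
  [PartialOrder C] [StarOrderedRing C] [PartialOrder D] [StarOrderedRing D]
  [PartialOrder C₁] [StarOrderedRing C₁] [PartialOrder D₁] [StarOrderedRing D₁]

/-- A realization of the upward basic construction `C ⊗_A X ⊗_B D̃` as a
`C₁–D₁`-equivalence bimodule, where `M` is the middle `A–B`-equivalence bimodule
(`X` regarded as an `A–B`-bimodule), together with the canonical trilinear map `t`
(the map `(c, x, d) ↦ c ⊗ x ⊗ d̃`, conjugate-linear in the last variable). -/
structure IsUpwardBasic {Xc T : Type*}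
    [NormedAddCommGroup Xc] [NormedSpace ℂ Xc] [CompleteSpace Xc]
    [NormedAddCommGroup T] [NormedSpace ℂ T] [CompleteSpace T]
    (ιA : A →⋆ₐ[ℂ] C) (ιB : B →⋆ₐ[ℂ] D)
    (EA : CondExpectation ιA) (EB : CondExpectation ιB)
    (M : EquivBimodule A B Xc)
    (ιC : C →⋆ₐ[ℂ] C₁) (eA : C₁) (ιD : D →⋆ₐ[ℂ] D₁) (eB : D₁)
    (F : EquivBimodule C₁ D₁ T) (t : C → Xc → D → T) : Prop where
  add₁ : ∀ c c' x d, t (c + c') x d = t c x d + t c' x d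
  smul₁ : ∀ (z : ℂ) c x d, t (z • c) x d = z • t c x d
  add₂ : ∀ c x x' d, t c (x + x') d = t c x d + t c x' d
  smul₂ : ∀ (z : ℂ) c x d, t c (z • x) d = z • t c x d
  add₃ : ∀ c x d d', t c x (d + d') = t c x d + t c x d'
  smul₃ : ∀ (z : ℂ) c x d, t c x (z • d) = (starRingEnd ℂ z) • t c x d
  balanced₁ : ∀ (a : A) c x d, t (c * ιA a) x d = t c (M.lsmul a x) d
  balanced₂ : ∀ (b : B) c x d, t c (M.rsmul x b) d = t c x (d * ιB (star b))
  map_lsmul : ∀ c' c x d, F.lsmul (ιC c') (t c x d) = t (c' * c) x d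
  map_eA : ∀ c x d, F.lsmul eA (t c x d) = t (ιA (EA.toFun c)) x d
  map_rsmul : ∀ c x d d', F.rsmul (t c x d) (ιD d') = t c x (star d' * d)
  map_eB : ∀ c x d, F.rsmul (t c x d) eB = t c x (ιB (EB.toFun d))
  linn_eq : ∀ c c' x x' d d',
    F.linn (t c x d) (t c' x' d') =
      ιC (c * ιA (M.linn (M.rsmul x (EB.toFun (star d * d'))) x')) * eA * ιC (star c')
  rinn_eq : ∀ c c' x x' d d',
    F.rinn (t c x d) (t c' x' d') =
      ιD d * eB * ιD (ιB (M.rinn x (M.lsmul (EA.toFun (star c * c')) x')) * star d')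
  dense : Dense (Submodule.span ℂ {v : T | ∃ c x d, v = t c x d} : Set T)

end Upward




/-! ### Basic facts on equivalence bimodules -/

theorem sesq_bound {Y C : Type*} [NormedAddCommGroup Y] [NormedSpace ℂ Y]
    [NormedAddCommGroup C] [NormedSpace ℂ C] (B : Y → Y → C)
    (ha : ∀ x y z, B (x + y) z = B x z + B y z)
    (hs : ∀ (t : ℂ) x y, B (t • x) y = t • B x y)
    (ha' : ∀ x y z, B x (y + z) = B x y + B x z)
    (hs' : ∀ (t : ℂ) x y, B x (t • y) = (starRingEnd ℂ t) • B x y)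
    (hn : ∀ x, ‖B x x‖ = ‖x‖ ^ 2) (x y : Y) : ‖B x y‖ ≤ 4 * ‖x‖ * ‖y‖ := by
  have pol : ∀ x y, (4 : ℂ) • B x y = B (x + y) (x + y) + (-1 : ℂ) • B (x + (-1 : ℂ) • y) (x + (-1 : ℂ) • y)
      + Complex.I • B (x + Complex.I • y) (x + Complex.I • y)
      + (-Complex.I) • B (x + (-Complex.I) • y) (x + (-Complex.I) • y) := by
    intro x y
    simp only [ha, ha', hs, hs', smul_add, smul_smul, map_neg, map_one, Complex.conj_I]
    match_scalars <;> ring_nf <;> simp [Complex.I_sq] <;> norm_num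
  have h1 : ∀ x y, ‖x‖ = 1 → ‖y‖ = 1 → ‖B x y‖ ≤ 4 := by
    intro x y hx hy
    have key : ∀ w : ℂ, ‖w‖ = 1 → ‖B (x + w • y) (x + w • y)‖ ≤ 4 := by
      intro w hw
      rw [hn]
      have : ‖x + w • y‖ ≤ 2 := by
        refine (norm_add_le _ _).trans ?_
        rw [norm_smul, hw, hx, hy]; norm_num
      nlinarith [norm_nonneg (x + w • y)]
    have e := congrArg norm (pol x y)
    rw [norm_smul] at e
    have k1 := key 1 (by simp)
    rw [one_smul] at k1
    have k2 := key (-1) (by simp)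
    have k3 := key Complex.I (by simp)
    have k4 := key (-Complex.I) (by simp)
    have t := (norm_add_le (B (x + y) (x + y) + (-1 : ℂ) • B (x + (-1 : ℂ) • y) (x + (-1 : ℂ) • y)
      + Complex.I • B (x + Complex.I • y) (x + Complex.I • y))
      ((-Complex.I) • B (x + (-Complex.I) • y) (x + (-Complex.I) • y))).trans
      (add_le_add_left ((norm_add_le _ _).trans (add_le_add_left (norm_add_le _ _) _)) _)
    rw [← e] at t
    simp only [norm_smul, norm_neg, norm_one, Complex.norm_I, one_mul] at t
    norm_num at t
    norm_num at k2 k3 k4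
    linarith
  by_cases hx : x = 0
  · have : B x y = 0 := by simpa [hx] using hs 0 0 y
    rw [this]; simp [hx]
  by_cases hy : y = 0
  · have : B x y = 0 := by simpa [hy] using hs' 0 x 0
    rw [this]; simp [hy]
  have hx' : ‖x‖ ≠ 0 := by simpa using hx
  have hy' : ‖y‖ ≠ 0 := by simpa using hy
  have := h1 (((‖x‖⁻¹ : ℝ) : ℂ) • x) (((‖y‖⁻¹ : ℝ) : ℂ) • y)
    (by rw [norm_smul]; simp [hx']) (by rw [norm_smul]; simp [hy'])
  rw [hs, hs', norm_smul, norm_smul] at this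
  simp at this
  have px : 0 < ‖x‖ := by positivity
  have py : 0 < ‖y‖ := by positivity
  rw [← mul_assoc, ← mul_inv, inv_mul_le_iff₀ (by positivity)] at this
  linarith

namespace EquivBimodule

variable {C D Y : Type*}
    [NonUnitalCStarAlgebra C] [PartialOrder C] [StarOrderedRing C]
    [NonUnitalCStarAlgebra D] [PartialOrder D] [StarOrderedRing D]
    [NormedAddCommGroup Y] [NormedSpace ℂ Y] [CompleteSpace Y] (E : EquivBimodule C D Y)

theorem linn_add_right (x y z : Y) : E.linn x (y + z) = E.linn x y + E.linn x z := by
  rw [← E.linn_star, E.linn_add_left, star_add, E.linn_star, E.linn_star]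

theorem linn_smul_right (t : ℂ) (x y : Y) :
    E.linn x (t • y) = (starRingEnd ℂ t) • E.linn x y := by
  rw [← E.linn_star, E.linn_smul_left, star_smul, E.linn_star]; rfl

theorem rinn_add_left (x y z : Y) : E.rinn (x + y) z = E.rinn x z + E.rinn y z := by
  rw [← E.rinn_star, E.rinn_add_right, star_add, E.rinn_star, E.rinn_star]

theorem rinn_smul_left (t : ℂ) (x y : Y) :
    E.rinn (t • x) y = (starRingEnd ℂ t) • E.rinn x y := by
  rw [← E.rinn_star, E.rinn_smul_right, star_smul, E.rinn_star]; rfl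

theorem linn_lsmul_right (c : C) (x y : Y) : E.linn x (E.lsmul c y) = E.linn x y * star c := by
  rw [← E.linn_star, E.linn_lsmul_left, star_mul, E.linn_star]

theorem rinn_rsmul_left (d : D) (x y : Y) : E.rinn (E.rsmul x d) y = star d * E.rinn x y := by
  rw [← E.rinn_star, E.rinn_rsmul_right, star_mul, E.rinn_star]

theorem norm_linn_le (x y : Y) : ‖E.linn x y‖ ≤ 4 * ‖x‖ * ‖y‖ :=
  sesq_bound E.linn E.linn_add_left E.linn_smul_left E.linn_add_right E.linn_smul_right
    E.norm_linn x y

theorem norm_rinn_le (x y : Y) : ‖E.rinn x y‖ ≤ 4 * ‖x‖ * ‖y‖ := by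
  have := sesq_bound (fun x y => E.rinn y x) (fun x y z => E.rinn_add_right z x y)
    (fun t x y => E.rinn_smul_right t y x) (fun x y z => E.rinn_add_left y z x)
    (fun t x y => E.rinn_smul_left t y x) E.norm_rinn y x
  linarith

theorem norm_lsmul_le (c : C) (x : Y) : ‖E.lsmul c x‖ ≤ ‖c‖ * ‖x‖ := by
  refine le_of_sq_le_sq ?_ (by positivity)
  rw [← E.norm_linn, E.linn_lsmul_left, E.linn_lsmul_right]
  refine (norm_mul_le _ _).trans ?_
  refine (mul_le_mul_of_nonneg_left (norm_mul_le _ _) (norm_nonneg _)).trans ?_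
  rw [norm_star, E.norm_linn]
  apply le_of_eq; ring

theorem norm_rsmul_le (x : Y) (d : D) : ‖E.rsmul x d‖ ≤ ‖d‖ * ‖x‖ := by
  refine le_of_sq_le_sq ?_ (by positivity)
  rw [← E.norm_rinn, E.rinn_rsmul_right, E.rinn_rsmul_left]
  refine (norm_mul_le _ _).trans ?_
  refine (mul_le_mul_of_nonneg_right (norm_mul_le _ _) (norm_nonneg _)).trans ?_
  rw [norm_star, E.norm_rinn]
  apply le_of_eq; ring

/-- The bounded left action. -/
def lsmulL (c : C) : Y →L[ℂ] Y :=
  LinearMap.mkContinuous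
    { toFun := E.lsmul c, map_add' := E.lsmul_add c, map_smul' := fun z x => E.lsmul_smul z c x }
    ‖c‖ (E.norm_lsmul_le c)

/-- The orbit map of the left action. -/
def lorbL (x : Y) : C →L[ℂ] Y :=
  LinearMap.mkContinuous
    { toFun := fun c => E.lsmul c x, map_add' := fun c c' => E.add_lsmul c c' x,
      map_smul' := fun z c => E.smul_lsmul z c x }
    ‖x‖ (fun c => by rw [mul_comm]; exact E.norm_lsmul_le c x)

/-- The bounded right action. -/
def rsmulL (d : D) : Y →L[ℂ] Y :=
  LinearMap.mkContinuous
    { toFun := fun x => E.rsmul x d, map_add' := fun x y => E.add_rsmul x y d,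
      map_smul' := fun z x => E.rsmul_smul z x d }
    ‖d‖ (fun x => E.norm_rsmul_le x d)

/-- The orbit map of the right action. -/
def rorbL (x : Y) : D →L[ℂ] Y :=
  LinearMap.mkContinuous
    { toFun := fun c => E.rsmul x c, map_add' := fun c c' => E.rsmul_add x c c',
      map_smul' := fun z c => E.smul_rsmul z x c }
    ‖x‖ (fun c => by rw [mul_comm]; exact E.norm_rsmul_le x c)

/-- The left inner product as a bounded linear map in the first variable. -/
def linnL (y : Y) : Y →L[ℂ] C :=
  LinearMap.mkContinuous
    { toFun := fun x => E.linn x y, map_add' := fun x x' => E.linn_add_left x x' y,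
      map_smul' := fun z c => E.linn_smul_left z c y }
    (4 * ‖y‖) (fun c => by
      have := E.norm_linn_le c y
      simp only [LinearMap.coe_mk, AddHom.coe_mk]; linarith)

/-- The right inner product as a bounded linear map in the second variable. -/
def rinnL (x : Y) : Y →L[ℂ] D :=
  LinearMap.mkContinuous
    { toFun := fun y => E.rinn x y, map_add' := fun y y' => E.rinn_add_right x y y',
      map_smul' := fun z c => E.rinn_smul_right z x c }
    (4 * ‖x‖) (fun c => by
      have := E.norm_rinn_le x c
      simp only [LinearMap.coe_mk, AddHom.coe_mk]; linarith)

theorem cont_lsmul (c : C) : Continuous (E.lsmul c) := (E.lsmulL c).continuous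
theorem cont_lorb (x : Y) : Continuous (fun c => E.lsmul c x) := (E.lorbL x).continuous
theorem cont_rsmul (d : D) : Continuous (fun x => E.rsmul x d) := (E.rsmulL d).continuous
theorem cont_rorb (x : Y) : Continuous (E.rsmul x) := (E.rorbL x).continuous
theorem cont_linn_left (y : Y) : Continuous (fun x => E.linn x y) := (E.linnL y).continuous
theorem cont_linn_right (x : Y) : Continuous (E.linn x) := by
  have : E.linn x = fun y => star (E.linn y x) := by ext y; rw [E.linn_star]
  rw [this]; exact (E.cont_linn_left x).star
theorem cont_rinn_right (x : Y) : Continuous (E.rinn x) := (E.rinnL x).continuous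
theorem cont_rinn_left (y : Y) : Continuous (fun x => E.rinn x y) := by
  have : (fun x => E.rinn x y) = fun x => star (E.rinn y x) := by ext y; rw [E.rinn_star]
  rw [this]; exact (E.cont_rinn_right y).star

/-- Induction principle for closed conditions on a submodule with dense span. -/
theorem _root_.dense_span_le {V : Type*} [NormedAddCommGroup V] [NormedSpace ℂ V] {S : Set V}
    (hS : Dense (Submodule.span ℂ S : Set V)) (M : Submodule ℂ V) (hM : IsClosed (M : Set V))
    (h : S ⊆ M) (v : V) : v ∈ M := by
  have : closure (Submodule.span ℂ S : Set V) ⊆ M :=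
    closure_minimal (Submodule.span_le.2 h) hM
  exact this (hS v)

theorem left_faithful (c : C) (h : ∀ y, E.lsmul c y = 0) : c = 0 := by
  let M : Submodule ℂ C := LinearMap.ker (LinearMap.mulLeft ℂ c)
  have hM : IsClosed (M : Set C) := by
    have : (M : Set C) = (fun x => c * x) ⁻¹' {0} := by ext; simp [M]
    rw [this]; exact isClosed_singleton.preimage (by fun_prop)
  have := dense_span_le E.full_left M hM (by
    rintro _ ⟨x, y, rfl⟩
    simp only [M, SetLike.mem_coe, LinearMap.mem_ker, LinearMap.mulLeft_apply]
    rw [← E.linn_lsmul_left, h]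
    simpa using E.linn_smul_left 0 0 y) (star c)
  have h2 : c * star c = 0 := by simpa [M] using this
  exact CStarRing.mul_star_self_eq_zero_iff c |>.1 h2

theorem right_faithful (c : D) (h : ∀ y, E.rsmul y c = 0) : c = 0 := by
  let M : Submodule ℂ D := LinearMap.ker (LinearMap.mulRight ℂ c)
  have hM : IsClosed (M : Set D) := by
    have : (M : Set D) = (fun x => x * c) ⁻¹' {0} := by ext; simp [M]
    rw [this]; exact isClosed_singleton.preimage (by fun_prop)
  have := dense_span_le E.full_right M hM (by
    rintro _ ⟨x, y, rfl⟩
    simp only [M, SetLike.mem_coe, LinearMap.mem_ker, LinearMap.mulRight_apply]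
    rw [← E.rinn_rsmul_right, h]
    simpa using E.rinn_smul_right 0 x 0) (star c)
  have h2 : star c * c = 0 := by simpa [M] using this
  exact CStarRing.star_mul_self_eq_zero_iff c |>.1 h2

theorem linn_rsmul (x y : Y) (d : D) : E.linn (E.rsmul x d) y = E.linn x (E.rsmul y (star d)) := by
  rw [← sub_eq_zero]
  refine E.left_faithful _ fun z => ?_
  have : E.lsmul (E.linn (E.rsmul x d) y - E.linn x (E.rsmul y (star d))) z =
    E.lsmul (E.linn (E.rsmul x d) y) z - E.lsmul (E.linn x (E.rsmul y (star d))) z :=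
    map_sub (E.lorbL z) _ _
  rw [this, E.imprimitivity, E.imprimitivity, E.rinn_rsmul_left, star_star, E.rsmul_mul, sub_self]

theorem rinn_lsmul (x y : Y) (c : C) : E.rinn x (E.lsmul c y) = E.rinn (E.lsmul (star c) x) y := by
  rw [← sub_eq_zero]
  refine E.right_faithful _ fun z => ?_
  have : E.rsmul z (E.rinn x (E.lsmul c y) - E.rinn (E.lsmul (star c) x) y) =
    E.rsmul z (E.rinn x (E.lsmul c y)) - E.rsmul z (E.rinn (E.lsmul (star c) x) y) :=
    map_sub (E.rorbL z) _ _
  rw [this, ← E.imprimitivity, ← E.imprimitivity, E.linn_lsmul_right, star_star, E.mul_lsmul,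
    sub_self]

end EquivBimodule

/-! ### The density argument -/

section Density

variable {Y Cs : Type*} [NormedAddCommGroup Y] [NormedSpace ℂ Y]

/-- Span of the homogeneous pieces with index in `s`. -/
def pieceSpan (Xk : ℕ → Set Y) (s : Set ℕ) : Submodule ℂ Y :=
  Submodule.span ℂ {x | ∃ k ∈ s, x ∈ Xk k}

theorem pieceSpan_mono (Xk : ℕ → Set Y) {s t : Set ℕ} (h : s ⊆ t) :
    pieceSpan Xk s ≤ pieceSpan Xk t :=
  Submodule.span_mono (fun _ ⟨k, hk, hx⟩ => ⟨k, h hk, hx⟩)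

theorem pieceSpan_finite (Xk : ℕ → Set Y) (x : Y) (hx : x ∈ pieceSpan Xk Set.univ) :
    ∃ N, x ∈ pieceSpan Xk (Set.Iio N) := by
  unfold pieceSpan at hx
  induction hx using Submodule.span_induction with
  | mem x h =>
    obtain ⟨k, -, hk⟩ := h
    exact ⟨k + 1, Submodule.subset_span ⟨k, by simp, hk⟩⟩
  | zero => exact ⟨0, zero_mem _⟩
  | add x y _ _ h1 h2 =>
    obtain ⟨N, hN⟩ := h1
    obtain ⟨M, hM⟩ := h2
    exact ⟨max N M, add_mem
      (pieceSpan_mono Xk (Set.Iio_subset_Iio (le_max_left _ _)) hN)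
      (pieceSpan_mono Xk (Set.Iio_subset_Iio (le_max_right _ _)) hM)⟩
  | smul z x _ h =>
    obtain ⟨N, hN⟩ := h
    exact ⟨N, Submodule.smul_mem _ _ hN⟩

variable [NormedAddCommGroup Cs] [NormedSpace ℂ Cs]

theorem pieceSpan_orth (B : Y → Y → Cs)
    (ha : ∀ x y z, B (x + y) z = B x z + B y z)
    (hs : ∀ (t : ℂ) x y, B (t • x) y = t • B x y)
    (ha' : ∀ x y z, B x (y + z) = B x y + B x z)
    (hs' : ∀ (t : ℂ) x y, B x (t • y) = (starRingEnd ℂ t) • B x y)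
    (Xk : ℕ → Set Y) (ho : ∀ k l, k ≠ l → ∀ x ∈ Xk k, ∀ y ∈ Xk l, B x y = 0)
    {s t : Set ℕ} (hst : Disjoint s t) (x y : Y) (hx : x ∈ pieceSpan Xk s)
    (hy : y ∈ pieceSpan Xk t) : B x y = 0 := by
  have z1 : ∀ y, B 0 y = 0 := fun y => by simpa using hs 0 0 y
  have z2 : ∀ y, B y 0 = 0 := fun y => by simpa using hs' 0 y 0
  unfold pieceSpan at hx hy
  induction hx using Submodule.span_induction with
  | mem x h =>
    obtain ⟨k, hk, hxk⟩ := h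
    induction hy using Submodule.span_induction with
    | mem y h =>
      obtain ⟨l, hl, hyl⟩ := h
      exact ho k l (fun h => Set.disjoint_left.1 hst hk (h ▸ hl)) x hxk y hyl
    | zero => exact z2 _
    | add y y' _ _ h1 h2 => rw [ha', h1, h2, add_zero]
    | smul z y _ h => rw [hs', h, smul_zero]
  | zero => exact z1 _
  | add x x' _ _ h1 h2 => rw [ha, h1, h2, add_zero]
  | smul z y _ h => rw [hs, h, smul_zero]

theorem density_aux (B : Y → Y → Cs)
    (ha : ∀ x y z, B (x + y) z = B x z + B y z)
    (hs : ∀ (t : ℂ) x y, B (t • x) y = t • B x y)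
    (ha' : ∀ x y z, B x (y + z) = B x y + B x z)
    (hs' : ∀ (t : ℂ) x y, B x (t • y) = (starRingEnd ℂ t) • B x y)
    (Xk : ℕ → Set Y) (ho : ∀ k l, k ≠ l → ∀ x ∈ Xk k, ∀ y ∈ Xk l, B x y = 0)
    (X : Submodule ℂ Y) (hX : ∀ k, Xk k ⊆ X)
    (hd : (X : Set Y) ⊆ closure (pieceSpan Xk Set.univ : Set Y))
    (S : Set Cs) (hS : ∀ s ∈ S, ∀ k, ∃ x ∈ Xk k, ∃ y ∈ Xk k, B x y = s)
    (g : Cs) (hg : g ∈ closure (Submodule.span ℂ S : Set Cs))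
    (ε : ℝ) (hε : 0 < ε) (t : Y) (ht : t ∈ X) (δ : ℝ) (hδ : 0 < δ) :
    ∃ t' ∈ X, ‖t' - t‖ < δ ∧ ∃ x ∈ X, ‖B x t' - g‖ < ε := by
  have hVX : ∀ s, pieceSpan Xk s ≤ X := fun s =>
    Submodule.span_le.2 (fun x ⟨k, _, hk⟩ => hX k hk)
  have orth := fun {s t} => @pieceSpan_orth Y Cs _ _ _ _ B ha hs ha' hs' Xk ho s t
  -- realize elements of the span of `S` as single inner products, far away
  have P : ∀ a ∈ Submodule.span ℂ S, ∀ N, ∃ M, ∃ x ∈ pieceSpan Xk (Set.Ico N M),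
      ∃ y ∈ pieceSpan Xk (Set.Ico N M), B x y = a := by
    intro a h
    induction h using Submodule.span_induction with
    | mem a h =>
      intro N
      obtain ⟨x, hx, y, hy, e⟩ := hS a h N
      exact ⟨N + 1, x, Submodule.subset_span ⟨N, by simp, hx⟩, y,
        Submodule.subset_span ⟨N, by simp, hy⟩, e⟩
    | zero => exact fun N => ⟨N, 0, zero_mem _, 0, zero_mem _, by simpa using hs 0 0 0⟩
    | add a b _ _ h1 h2 =>
      intro N
      obtain ⟨M, x, hx, y, hy, e⟩ := h1 N
      obtain ⟨L, x', hx', y', hy', e'⟩ := h2 (max N M)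
      have m1 : Set.Ico N M ⊆ Set.Ico N (max M L) := by
        intro i hi; simp only [Set.mem_Ico] at hi ⊢; omega
      have m2 : Set.Ico (max N M) L ⊆ Set.Ico N (max M L) := by
        intro i hi; simp only [Set.mem_Ico] at hi ⊢; omega
      have dj : Disjoint (Set.Ico N M) (Set.Ico (max N M) L) := by
        rw [Set.disjoint_left]; intro i hi hi'; simp only [Set.mem_Ico] at hi hi'; omega
      refine ⟨max M L, x + x', add_mem (pieceSpan_mono Xk m1 hx) (pieceSpan_mono Xk m2 hx'),
        y + y', add_mem (pieceSpan_mono Xk m1 hy) (pieceSpan_mono Xk m2 hy'), ?_⟩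
      rw [ha, ha', ha', e, e', orth dj x y' hx hy', orth dj.symm x' y hx' hy]
      simp
    | smul z a _ h =>
      intro N
      obtain ⟨M, x, hx, y, hy, e⟩ := h N
      exact ⟨M, z • x, Submodule.smul_mem _ _ hx, y, hy, by rw [hs, e]⟩
  obtain ⟨t0, ht0, ht0'⟩ := Metric.mem_closure_iff.1 (hd ht) (δ / 2) (by positivity)
  obtain ⟨N, hN⟩ := pieceSpan_finite Xk t0 ht0
  obtain ⟨g', hg', hgg⟩ := Metric.mem_closure_iff.1 hg ε hε
  obtain ⟨M, x, hx, y, hy, e⟩ := P g' hg' N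
  set η : ℝ := δ / (2 * (‖y‖ + 1)) with hη
  have hη0 : 0 < η := by positivity
  have hηy : η * ‖y‖ < δ / 2 := by
    rw [hη, div_mul_eq_mul_div, div_lt_div_iff₀ (by positivity) (by norm_num)]
    nlinarith [norm_nonneg y]
  refine ⟨t0 + (η : ℂ) • y, add_mem (hVX _ hN) (Submodule.smul_mem _ _ (hVX _ hy)), ?_,
    ((η⁻¹ : ℝ) : ℂ) • x, Submodule.smul_mem _ _ (hVX _ hx), ?_⟩
  · have : t0 + (η : ℂ) • y - t = -(t - t0) + (η : ℂ) • y := by abel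
    rw [this]
    refine (norm_add_le _ _).trans_lt ?_
    rw [norm_neg, ← dist_eq_norm, norm_smul]
    simp only [Complex.norm_real, Real.norm_eq_abs, abs_of_pos hη0]
    linarith
  · have dj : Disjoint (Set.Ico N M) (Set.Iio N) := by
      rw [Set.disjoint_left]; intro i hi hi'; simp only [Set.mem_Ico, Set.mem_Iio] at hi hi'; omega
    rw [ha', hs, hs', hs, orth dj x t0 hx hN, e, smul_zero, zero_add, smul_smul]
    have : (starRingEnd ℂ (η : ℂ)) * ((η⁻¹ : ℝ) : ℂ) = 1 := by
      rw [Complex.conj_ofReal, ← Complex.ofReal_mul, mul_inv_cancel₀ hη0.ne']; simp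
    rw [this, one_smul, ← dist_eq_norm, dist_comm]
    exact hgg

end Density

theorem exists_approx_unit {A : Type*} [NonUnitalCStarAlgebra A] (b : A) (ε : ℝ) (hε : 0 < ε) :
    ∃ a : A, ‖a‖ ≤ 1 ∧ ‖b - b * a‖ < ε := by
  let _ := CStarAlgebra.spectralOrder A
  let _ := CStarAlgebra.spectralOrderedRing A
  have h := CStarAlgebra.increasingApproximateUnit A
  have h1 := h.tendsto_mul_left b
  have h2 := (Metric.tendsto_nhds.1 h1 ε hε).and h.eventually_norm
  obtain ⟨a, ha, ha'⟩ := h2.exists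
  exact ⟨a, ha', by rwa [dist_comm, dist_eq_norm] at ha⟩

/-- One side of an equivalence bimodule, with the action written as a right action. -/
structure OneSided {Cs Y : Type*} [NonUnitalCStarAlgebra Cs]
    [NormedAddCommGroup Y] [NormedSpace ℂ Y]
    (act : Cs → Y → Y) (B Bo : Y → Y → Cs) : Prop where
  act_add_left : ∀ d d' x, act (d + d') x = act d x + act d' x
  act_smul_left : ∀ (z : ℂ) d x, ∃ z' : ℂ, act (z • d) x = z' • act d x
  act_add_right : ∀ d x y, act d (x + y) = act d x + act d y
  act_smul_right : ∀ (z : ℂ) d x, act d (z • x) = z • act d x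
  act_mul : ∀ d d' x, act (d * d') x = act d' (act d x)
  act_cont_left : ∀ x, Continuous (fun d => act d x)
  act_cont_right : ∀ d, Continuous (act d)
  B_add_left : ∀ x y z, B (x + y) z = B x z + B y z
  B_smul_left : ∀ (t : ℂ) x y, B (t • x) y = t • B x y
  B_add_right : ∀ x y z, B x (y + z) = B x y + B x z
  B_smul_right : ∀ (t : ℂ) x y, B x (t • y) = (starRingEnd ℂ t) • B x y
  B_adj : ∀ d x y, B (act d x) y = B x (act (star d) y)
  B_cont_left : ∀ y, Continuous (fun x => B x y)
  Bo_norm : ∀ x, ‖Bo x x‖ = ‖x‖ ^ 2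
  Bo_add_left : ∀ x y z, Bo (x + y) z = Bo x z + Bo y z
  Bo_add_right : ∀ x y z, Bo x (y + z) = Bo x y + Bo x z
  Bo_act_right : ∀ d x y, Bo x (act d y) = Bo x y * d
  Bo_act_left : ∀ d x y, Bo (act d x) y = star d * Bo x y

namespace EquivBimodule

variable {C Y : Type*}
    [NonUnitalCStarAlgebra C] [PartialOrder C] [StarOrderedRing C]
    [NormedAddCommGroup Y] [NormedSpace ℂ Y] [CompleteSpace Y] (E : EquivBimodule C C Y)

theorem oneSided_right : OneSided (fun d x => E.rsmul x d) E.linn E.rinn where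
  act_add_left d d' x := E.rsmul_add x d d'
  act_smul_left z d x := ⟨z, E.smul_rsmul z x d⟩
  act_add_right d x y := E.add_rsmul x y d
  act_smul_right z d x := E.rsmul_smul z x d
  act_mul d d' x := E.rsmul_mul x d d'
  act_cont_left := E.cont_rorb
  act_cont_right := E.cont_rsmul
  B_add_left := E.linn_add_left
  B_smul_left := E.linn_smul_left
  B_add_right := E.linn_add_right
  B_smul_right := E.linn_smul_right
  B_adj d x y := E.linn_rsmul x y d
  B_cont_left := E.cont_linn_left
  Bo_norm := E.norm_rinn
  Bo_add_left := E.rinn_add_left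
  Bo_add_right := E.rinn_add_right
  Bo_act_right d x y := E.rinn_rsmul_right x y d
  Bo_act_left d x y := E.rinn_rsmul_left d x y

theorem oneSided_left :
    OneSided (fun d x => E.lsmul (star d) x) (fun x y => E.rinn y x) E.linn where
  act_add_left d d' x := by simp only [star_add, E.add_lsmul]
  act_smul_left z d x := ⟨star z, by simp only [star_smul, E.smul_lsmul]⟩
  act_add_right d x y := E.lsmul_add _ x y
  act_smul_right z d x := E.lsmul_smul z _ x
  act_mul d d' x := by simp only [star_mul, E.mul_lsmul]
  act_cont_left x := (E.cont_lorb x).comp continuous_star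
  act_cont_right d := E.cont_lsmul _
  B_add_left x y z := E.rinn_add_right z x y
  B_smul_left t x y := E.rinn_smul_right t y x
  B_add_right x y z := E.rinn_add_left y z x
  B_smul_right t x y := E.rinn_smul_left t y x
  B_adj d x y := E.rinn_lsmul y x (star d)
  B_cont_left := E.cont_rinn_right
  Bo_norm := E.norm_linn
  Bo_add_left := E.linn_add_left
  Bo_add_right := E.linn_add_right
  Bo_act_right d x y := by simp only [E.linn_lsmul_right, star_star]
  Bo_act_left d x y := E.linn_lsmul_left _ x y

end EquivBimodule

namespace OneSided

variable {Cs Y : Type*} [NonUnitalCStarAlgebra Cs]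
    [NormedAddCommGroup Y] [NormedSpace ℂ Y]
    {act : Cs → Y → Y} {B Bo : Y → Y → Cs}


theorem mem_closure_act (H : OneSided act B Bo) {As : Type*} [NonUnitalCStarAlgebra As] (ιs : As →⋆ₙₐ[ℂ] Cs)
    (hιs : Function.Injective ιs) (x : Y) (hx : Bo x x ∈ Set.range ιs) :
    x ∈ closure {y | ∃ a : As, y = act (ιs a) x} := by
  rw [Metric.mem_closure_iff]
  intro ε hε
  obtain ⟨b, hb⟩ := hx
  obtain ⟨a, ha, hab⟩ := exists_approx_unit b (ε ^ 2 / 2) (by positivity)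
  refine ⟨_, ⟨a, rfl⟩, ?_⟩
  rw [dist_eq_norm]
  set w := x - act (ιs a) x with hw
  have hxw : x = w + act (ιs a) x := by rw [hw]; abel
  have e1 : Bo x w = ιs (b - b * a) := by
    have := H.Bo_add_right x w (act (ιs a) x)
    rw [← hxw, H.Bo_act_right, ← hb] at this
    rw [map_sub, map_mul]; exact eq_sub_of_add_eq this.symm
  have e2 : Bo w w = ιs ((b - b * a) - star a * (b - b * a)) := by
    have := H.Bo_add_left w (act (ιs a) x) w
    rw [← hxw, H.Bo_act_left, e1] at this
    rw [map_sub, map_mul, map_star]; exact eq_sub_of_add_eq this.symm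
  have e3 := H.Bo_norm w
  rw [e2, NonUnitalStarAlgHom.norm_map ιs hιs] at e3
  have : ‖(b - b * a) - star a * (b - b * a)‖ < ε ^ 2 := by
    refine (norm_sub_le _ _).trans_lt ?_
    have h1 := norm_mul_le (star a) (b - b * a)
    rw [norm_star] at h1
    have h2 : ‖a‖ * ‖b - b * a‖ ≤ 1 * ‖b - b * a‖ := by gcongr
    linarith
  rw [e3] at this
  exact lt_of_pow_lt_pow_left₀ 2 hε.le this

end OneSided

/-- A system of matrix units with coefficients in `A`. -/
structure MatUnits {A Cs : Type*} [NonUnitalCStarAlgebra A] [NonUnitalCStarAlgebra Cs]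
    (g : ℕ → ℕ → A → Cs) : Prop where
  cont : ∀ i j, Continuous (g i j)
  mul : ∀ i j k l c d, g i j c * g k l d = if j = k then g i l (c * d) else 0
  map_star : ∀ i j c, star (g i j c) = g j i (star c)

theorem OneSided.density {A Cs Y : Type*} [NonUnitalCStarAlgebra A] [NonUnitalCStarAlgebra Cs]
    [NormedAddCommGroup Y] [NormedSpace ℂ Y]
    {act : Cs → Y → Y} {B Bo : Y → Y → Cs} (H : OneSided act B Bo)
    {g : ℕ → ℕ → A → Cs} (hg : MatUnits g)
    (h0 : A) (hsa : star h0 = h0) (hh0 : DenseRange (fun a : A => a * h0))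
    (R : Set Cs) (hR : R = closure (Submodule.span ℂ {x : Cs | ∃ i j a, x = g i j a} : Set Cs))
    (X : Submodule ℂ Y) (hXact : ∀ d ∈ R, ∀ x ∈ X, act d x ∈ X)
    (hXB : R ⊆ closure (Submodule.span ℂ {c | ∃ x ∈ X, ∃ y ∈ X, c = B x y} : Set Cs))
    (hXd : ∀ x ∈ X, x ∈ closure {y | ∃ d ∈ R, y = act d x})
    (r : Cs) (hr : r ∈ R)
    (ε : ℝ) (hε : 0 < ε) (t : Y) (ht : t ∈ X) (δ : ℝ) (hδ : 0 < δ) :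
    ∃ t' ∈ X, ‖t' - t‖ < δ ∧ ∃ x ∈ X, ‖B x t' - r‖ < ε := by
  have hgR : ∀ i j a, g i j a ∈ R := fun i j a => by
    rw [hR]; exact subset_closure (Submodule.subset_span ⟨i, j, a, rfl⟩)
  have act0 : ∀ x, act 0 x = 0 := fun x => by
    have := H.act_add_left 0 0 x
    simpa using this
  let Xk : ℕ → Set Y := fun k => {v | ∃ x ∈ X, ∃ j a, v = act (g j k a) x}
  let S : Set Cs := {s | ∃ x ∈ X, ∃ y ∈ X, ∃ j l a, s = B (act (g j l (a * h0)) x) y}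
  have Bact : ∀ x y j k a j' l b, B (act (g j k a) x) (act (g j' l b) y) =
      B (act (if k = l then g j j' (a * star b) else 0) x) y := by
    intro x y j k a j' l b
    have := H.B_adj (star (g j' l b)) (act (g j k a) x) y
    rw [star_star] at this
    rw [← this, ← H.act_mul, hg.map_star, hg.mul]
  let T : Submodule ℂ Y := Submodule.span ℂ {v | ∃ x ∈ X, ∃ j l a, v = act (g j l (a * h0)) x}
  have hT : (X : Set Y) ⊆ closure (T : Set Y) := by
    intro x hx
    rw [← Submodule.topologicalClosure_coe]
    have hcl : IsClosed (T.topologicalClosure : Set Y) := Submodule.isClosed_topologicalClosure _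
    refine closure_minimal ?_ hcl (hXd x hx)
    rintro _ ⟨d, hd, rfl⟩
    rw [hR] at hd
    have hcl2 : IsClosed {d | act d x ∈ T.topologicalClosure} := hcl.preimage (H.act_cont_left x)
    refine closure_minimal ?_ hcl2 hd
    intro d hd
    change act d x ∈ T.topologicalClosure
    simp only [SetLike.mem_coe] at hd
    induction hd using Submodule.span_induction with
    | mem d h =>
      obtain ⟨i, j, a, rfl⟩ := h
      refine hh0.induction_on (p := fun a => act (g i j a) x ∈ T.topologicalClosure) a ?_ ?_
      · exact hcl2.preimage (hg.cont i j)
      · intro a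
        exact Submodule.le_topologicalClosure _ (Submodule.subset_span ⟨x, hx, i, j, a, rfl⟩)
    | zero => rw [act0]; exact zero_mem _
    | add d d' _ _ h1 h2 => rw [H.act_add_left]; exact add_mem h1 h2
    | smul z d _ h =>
      obtain ⟨z', hz⟩ := H.act_smul_left z d x
      rw [hz]; exact Submodule.smul_mem _ _ h
  refine density_aux B H.B_add_left H.B_smul_left H.B_add_right H.B_smul_right Xk ?_ X ?_ ?_ S ?_ r ?_
    ε hε t ht δ hδ
  · rintro k l hkl _ ⟨x, hx, j, a, rfl⟩ _ ⟨y, hy, j', b, rfl⟩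
    rw [Bact, if_neg hkl, act0]
    simpa using H.B_smul_left 0 0 y
  · rintro k _ ⟨x, hx, j, a, rfl⟩
    exact hXact _ (hgR _ _ _) _ hx
  · refine hT.trans (closure_mono ?_)
    refine Submodule.span_mono ?_
    rintro _ ⟨x, hx, j, l, a, rfl⟩
    exact ⟨l, trivial, x, hx, j, _, rfl⟩
  · rintro _ ⟨x, hx, y, hy, j, l, a, rfl⟩ k
    refine ⟨_, ⟨x, hx, j, a, rfl⟩, _, ⟨y, hy, l, h0, rfl⟩, ?_⟩
    rw [Bact, if_pos rfl, hsa]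
  · rw [← Submodule.topologicalClosure_coe]
    have hcl : IsClosed ((Submodule.span ℂ S).topologicalClosure : Set Cs) :=
      Submodule.isClosed_topologicalClosure _
    refine closure_minimal ?_ hcl (hXB hr)
    refine Submodule.span_le.2 ?_
    rintro _ ⟨x, hx, y, hy, rfl⟩
    refine closure_minimal ?_ (hcl.preimage (H.B_cont_left y)) (hT hx)
    intro v hv
    simp only [SetLike.mem_coe] at hv
    simp only [Set.mem_preimage, SetLike.mem_coe]
    induction hv using Submodule.span_induction with
    | mem v h =>
      obtain ⟨x, hx, j, l, a, rfl⟩ := h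
      exact Submodule.le_topologicalClosure _
        (Submodule.subset_span ⟨x, hx, y, hy, j, l, a, rfl⟩)
    | zero =>
      have : B 0 y = 0 := by simpa using H.B_smul_left 0 0 y
      rw [this]; exact zero_mem _
    | add d d' _ _ h1 h2 => rw [H.B_add_left]; exact add_mem h1 h2
    | smul z d _ h => rw [H.B_smul_left]; exact Submodule.smul_mem _ _ h

/-- Existence of an element `t` of `X` such that `⟨X, t⟩` (left) and `⟨t, X⟩` (right) approximate
a given countable family in `A`. -/
theorem exists_generator {A As Cs Y : Type*} [NonUnitalCStarAlgebra A] [NonUnitalCStarAlgebra As]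
    [NonUnitalCStarAlgebra Cs] [PartialOrder Cs] [StarOrderedRing Cs]
    [NormedAddCommGroup Y] [NormedSpace ℂ Y] [CompleteSpace Y]
    (F : EquivBimodule Cs Cs Y) (X : Submodule ℂ Y)
    (ιs : As →⋆ₙₐ[ℂ] Cs) (hιs : Function.Injective ιs) (hX : IsEquiPair ιs F X)
    {g : ℕ → ℕ → A → Cs} (hg : MatUnits g)
    (h0 : A) (hsa : star h0 = h0) (hh0 : DenseRange (fun a : A => a * h0))
    (hR : Set.range ιs = closure (Submodule.span ℂ {x : Cs | ∃ i j a, x = g i j a} : Set Cs)) :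
    ∃ t ∈ X, ∀ j, g j j h0 ∈ closure {c | ∃ x ∈ X, c = F.linn x t} ∧
      g j j h0 ∈ closure {c | ∃ x ∈ X, c = F.rinn t x} := by
  have hgR : ∀ i j a, g i j a ∈ Set.range ιs := fun i j a => by
    rw [hR]; exact subset_closure (Submodule.subset_span ⟨i, j, a, rfl⟩)
  have dR := F.oneSided_right.density hg h0 hsa hh0 (Set.range ιs) hR X
    (by rintro _ ⟨a, rfl⟩ x hx; exact hX.rsmul_mem a x hx)
    (by rw [← hX.span_XX_left])
    (fun x hx => closure_mono (by rintro _ ⟨a, rfl⟩; exact ⟨_, ⟨a, rfl⟩, rfl⟩)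
      (F.oneSided_right.mem_closure_act ιs hιs x (hX.rinn_mem x hx x hx)))
  have dL := F.oneSided_left.density hg h0 hsa hh0 (Set.range ιs) hR X
    (by rintro _ ⟨a, rfl⟩ x hx; rw [← map_star]; exact hX.lsmul_mem (star a) x hx)
    (by
      rw [← hX.span_XX_right]
      refine closure_mono (Submodule.span_mono ?_)
      rintro _ ⟨x, hx, y, hy, rfl⟩; exact ⟨y, hy, x, hx, rfl⟩)
    (fun x hx => closure_mono (by rintro _ ⟨a, rfl⟩; exact ⟨_, ⟨a, rfl⟩, rfl⟩)
      (F.oneSided_left.mem_closure_act ιs hιs x (hX.linn_mem x hx x hx)))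
  have : CompleteSpace X := hX.closed.completeSpace_coe
  let O : ℕ × ℕ → Set X := fun p => {t | ∃ x ∈ X, ‖F.linn x t - g p.1 p.1 h0‖ < 1 / (p.2 + 1 : ℝ)}
  let O' : ℕ × ℕ → Set X := fun p => {t | ∃ x ∈ X, ‖F.rinn t x - g p.1 p.1 h0‖ < 1 / (p.2 + 1 : ℝ)}
  have oO : ∀ p, IsOpen (O p) := by
    intro p
    have : O p = ⋃ x ∈ X, {t : X | ‖F.linn x t - g p.1 p.1 h0‖ < 1 / (p.2 + 1 : ℝ)} := by
      ext t; simp [O]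
    rw [this]
    refine isOpen_biUnion fun x _ => isOpen_lt ?_ continuous_const
    exact (((F.cont_linn_right x).comp continuous_subtype_val).sub continuous_const).norm
  have oO' : ∀ p, IsOpen (O' p) := by
    intro p
    have : O' p = ⋃ x ∈ X, {t : X | ‖F.rinn t x - g p.1 p.1 h0‖ < 1 / (p.2 + 1 : ℝ)} := by
      ext t; simp [O']
    rw [this]
    refine isOpen_biUnion fun x _ => isOpen_lt ?_ continuous_const
    exact (((F.cont_rinn_left x).comp continuous_subtype_val).sub continuous_const).norm
  have dO : ∀ p, Dense (O p) := by
    intro p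
    rw [Metric.dense_iff]
    intro t δ hδ
    obtain ⟨t', ht', h1, x, hx, h2⟩ := dR (g p.1 p.1 h0) (hgR _ _ _) (1 / (p.2 + 1 : ℝ))
      (by positivity) t t.2 δ hδ
    refine ⟨⟨t', ht'⟩, ?_, x, hx, h2⟩
    rw [Metric.mem_ball, Subtype.dist_eq, dist_eq_norm]; exact h1
  have dO' : ∀ p, Dense (O' p) := by
    intro p
    rw [Metric.dense_iff]
    intro t δ hδ
    obtain ⟨t', ht', h1, x, hx, h2⟩ := dL (g p.1 p.1 h0) (hgR _ _ _) (1 / (p.2 + 1 : ℝ))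
      (by positivity) t t.2 δ hδ
    refine ⟨⟨t', ht'⟩, ?_, x, hx, h2⟩
    rw [Metric.mem_ball, Subtype.dist_eq, dist_eq_norm]; exact h1
  have key := dense_iInter_of_isOpen (f := fun s : (ℕ × ℕ) ⊕ (ℕ × ℕ) => Sum.elim O O' s)
    (by rintro (p | p); exacts [oO p, oO' p]) (by rintro (p | p); exacts [dO p, dO' p])
  obtain ⟨t, ht⟩ := key.nonempty
  rw [Set.mem_iInter] at ht
  refine ⟨t, t.2, fun j => ⟨?_, ?_⟩⟩
  · rw [Metric.mem_closure_iff]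
    intro ε hε
    obtain ⟨n, hn⟩ := exists_nat_one_div_lt hε
    obtain ⟨x, hx, h⟩ := ht (Sum.inl (j, n))
    exact ⟨_, ⟨x, hx, rfl⟩, by rw [dist_comm, dist_eq_norm]; exact h.trans hn⟩
  · rw [Metric.mem_closure_iff]
    intro ε hε
    obtain ⟨n, hn⟩ := exists_nat_one_div_lt hε
    obtain ⟨x, hx, h⟩ := ht (Sum.inr (j, n))
    exact ⟨_, ⟨x, hx, rfl⟩, by rw [dist_comm, dist_eq_norm]; exact h.trans hn⟩

theorem exists_sqrt_mem {As Cs : Type*} [NonUnitalCStarAlgebra As]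
    [NonUnitalCStarAlgebra Cs] [PartialOrder Cs] [StarOrderedRing Cs]
    (ιs : As →⋆ₙₐ[ℂ] Cs) (hcl : IsClosed (Set.range ιs))
    (l : Cs) (hl : 0 ≤ l) (hlR : l ∈ Set.range ιs) :
    ∃ k : As, star (ιs k) = ιs k ∧ ιs k * ιs k = l := by
  let S : NonUnitalStarSubalgebra ℂ Cs := NonUnitalStarAlgHom.range ιs
  have hS : IsClosed (S : Set Cs) := by
    convert hcl
    ext x; simp [S]
  have hm : CFC.sqrt l ∈ S := by
    rw [CFC.sqrt_eq_real_sqrt l hl]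
    exact cfcₙ_mem (𝕜' := ℂ) (s := S) Real.sqrt (by simpa [S] using hlR)
  obtain ⟨k, hk⟩ : ∃ k, ιs k = CFC.sqrt l := by simpa [S] using hm
  refine ⟨k, ?_, ?_⟩
  · rw [hk]; exact (CFC.sqrt_nonneg l).isSelfAdjoint.star_eq
  · rw [hk]; exact CFC.sqrt_mul_sqrt_self l hl

/-- Any closed subspace of `Cs` that is a left ideal for the matrix units and contains all
`g j j h0` contains everything. -/
theorem left_ideal_top {A Cs : Type*} [NonUnitalCStarAlgebra A] [NonUnitalCStarAlgebra Cs]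
    {g : ℕ → ℕ → A → Cs} (hg : MatUnits g)
    (h0 : A) (hh0 : DenseRange (fun a : A => a * h0)) (M : Submodule ℂ Cs)
    (hM : IsClosed (M : Set Cs)) (hl : ∀ i j a, ∀ m ∈ M, g i j a * m ∈ M)
    (hm : ∀ j, g j j h0 ∈ M) :
    closure (Submodule.span ℂ {x : Cs | ∃ i j a, x = g i j a} : Set Cs) ⊆ M := by
  refine closure_minimal (Submodule.span_le.2 ?_) hM
  rintro _ ⟨i, j, a, rfl⟩
  refine hh0.induction_on (p := fun a => g i j a ∈ M) a ?_ ?_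
  · exact hM.preimage (hg.cont i j)
  · intro a
    have := hl i j a _ (hm j)
    rwa [hg.mul, if_pos rfl] at this

theorem right_ideal_top {A Cs : Type*} [NonUnitalCStarAlgebra A] [NonUnitalCStarAlgebra Cs]
    {g : ℕ → ℕ → A → Cs} (hg : MatUnits g)
    (h0 : A) (hh0 : DenseRange (fun a : A => h0 * a)) (M : Submodule ℂ Cs)
    (hM : IsClosed (M : Set Cs)) (hl : ∀ i j a, ∀ m ∈ M, m * g i j a ∈ M)
    (hm : ∀ j, g j j h0 ∈ M) :
    closure (Submodule.span ℂ {x : Cs | ∃ i j a, x = g i j a} : Set Cs) ⊆ M := by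
  refine closure_minimal (Submodule.span_le.2 ?_) hM
  rintro _ ⟨i, j, a, rfl⟩
  refine hh0.induction_on (p := fun a => g i j a ∈ M) a ?_ ?_
  · exact hM.preimage (hg.cont i j)
  · intro a
    have := hl i j a _ (hm i)
    rwa [hg.mul, if_pos rfl] at this

theorem generator_facts {A As Cs Y : Type*} [NonUnitalCStarAlgebra A] [NonUnitalCStarAlgebra As]
    [NonUnitalCStarAlgebra Cs] [PartialOrder Cs] [StarOrderedRing Cs]
    [NormedAddCommGroup Y] [NormedSpace ℂ Y] [CompleteSpace Y]
    (F : EquivBimodule Cs Cs Y) (X : Submodule ℂ Y)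
    (ιs : As →⋆ₙₐ[ℂ] Cs) (hιs : Function.Injective ιs) (hds : DenseIncl ⇑ιs)
    (hX : IsEquiPair ιs F X)
    {g : ℕ → ℕ → A → Cs} (hg : MatUnits g)
    (h0 : A) (hsa : star h0 = h0) (hh0 : DenseRange (fun a : A => a * h0))
    (hh0' : DenseRange (fun a : A => h0 * a))
    (hR : Set.range ιs = closure (Submodule.span ℂ {x : Cs | ∃ i j a, x = g i j a} : Set Cs)) :
    ∃ t ∈ X, ∃ k : As, star (ιs k) = ιs k ∧ ιs k * ιs k = F.linn t t ∧
      (X : Set Y) ⊆ closure (Set.range fun a => F.lsmul (ιs a) t) ∧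
      Set.range ιs ⊆ closure (Set.range fun a => ιs a * ιs k) ∧
      DenseRange (fun c => c * ιs k) ∧ DenseRange (fun c => F.lsmul c t) := by
  obtain ⟨t, htX, ht⟩ := exists_generator F X ιs hιs hX hg h0 hsa hh0 hR
  have hgR : ∀ i j a, g i j a ∈ Set.range ιs := fun i j a => by
    rw [hR]; exact subset_closure (Submodule.subset_span ⟨i, j, a, rfl⟩)
  have h1 : Set.range ιs ⊆ closure {c | ∃ x ∈ X, c = F.linn x t} := by
    have e : {c | ∃ x ∈ X, c = F.linn x t} = (X.map (F.linnL t : Y →ₗ[ℂ] Cs) : Set Cs) := by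
      ext c; constructor
      · rintro ⟨x, hx, rfl⟩; exact ⟨x, hx, rfl⟩
      · rintro ⟨x, hx, rfl⟩; exact ⟨x, hx, rfl⟩
    rw [hR]
    rw [e] at ht ⊢
    rw [← Submodule.topologicalClosure_coe]
    refine left_ideal_top hg h0 hh0 _ (Submodule.isClosed_topologicalClosure _) ?_
      (fun j => (ht j).1)
    intro i j a m hm
    obtain ⟨a', ha'⟩ := hgR i j a
    refine map_mem_closure (f := fun m => g i j a * m) (by fun_prop) hm ?_
    rintro _ ⟨x, hx, rfl⟩
    refine ⟨F.lsmul (ιs a') x, hX.lsmul_mem a' x hx, ?_⟩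
    rw [← ha']; exact F.linn_lsmul_left _ _ _
  have h2 : Set.range ιs ⊆ closure {c | ∃ x ∈ X, c = F.rinn t x} := by
    have e : {c | ∃ x ∈ X, c = F.rinn t x} = (X.map (F.rinnL t : Y →ₗ[ℂ] Cs) : Set Cs) := by
      ext c; constructor
      · rintro ⟨x, hx, rfl⟩; exact ⟨x, hx, rfl⟩
      · rintro ⟨x, hx, rfl⟩; exact ⟨x, hx, rfl⟩
    rw [hR]
    rw [e] at ht ⊢
    rw [← Submodule.topologicalClosure_coe]
    refine right_ideal_top hg h0 hh0' _ (Submodule.isClosed_topologicalClosure _) ?_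
      (fun j => (ht j).2)
    intro i j a m hm
    obtain ⟨a', ha'⟩ := hgR i j a
    refine map_mem_closure (f := fun m => m * g i j a) (by fun_prop) hm ?_
    rintro _ ⟨x, hx, rfl⟩
    refine ⟨F.rsmul x (ιs a'), hX.rsmul_mem a' x hx, ?_⟩
    rw [← ha']; exact F.rinn_rsmul_right _ _ _
  have h3 : (X : Set Y) ⊆ closure (Set.range fun a => F.lsmul (ιs a) t) := by
    intro x hx
    refine closure_minimal ?_ isClosed_closure
      (F.oneSided_right.mem_closure_act ιs hιs x (hX.rinn_mem x hx x hx))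
    rintro _ ⟨a, rfl⟩
    have := h2 ⟨star a, rfl⟩
    have h' := map_mem_closure (f := fun c => F.rsmul x (star c))
      ((F.cont_rorb x).comp continuous_star) this (t := Set.range fun a => F.lsmul (ιs a) t) (by
        rintro _ ⟨y, hy, rfl⟩
        obtain ⟨b, hb⟩ := hX.linn_mem x hx y hy
        refine ⟨b, ?_⟩
        simp only [hb, F.rinn_star, F.imprimitivity])
    simpa only [map_star, star_star] using h'
  have hcl : IsClosed (Set.range ιs) := by rw [hR]; exact isClosed_closure
  obtain ⟨k, hk1, hk2⟩ := exists_sqrt_mem ιs hcl (F.linn t t) (F.linn_nonneg t)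
    (hX.linn_mem t htX t htX)
  have h4 : Set.range ιs ⊆ closure (Set.range fun a => ιs a * F.linn t t) := by
    refine h1.trans (closure_minimal ?_ isClosed_closure)
    rintro _ ⟨x, hx, rfl⟩
    refine map_mem_closure (f := fun x => F.linn x t) (F.cont_linn_left t) (h3 hx) ?_
    rintro _ ⟨a, rfl⟩
    exact ⟨a, (F.linn_lsmul_left _ _ _).symm⟩
  have h5 : Set.range ιs ⊆ closure (Set.range fun a => ιs a * ιs k) := by
    refine h4.trans (closure_mono ?_)
    rintro _ ⟨a, rfl⟩
    exact ⟨a * k, by simp only [map_mul, mul_assoc, hk2]⟩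
  refine ⟨t, htX, k, hk1, hk2, h3, h5, ?_, ?_⟩
  · have e : (Set.range fun c => c * ιs k) =
        (LinearMap.range (LinearMap.mulRight ℂ (ιs k)) : Set Cs) := by
      ext; simp
    intro c
    rw [e, ← Submodule.topologicalClosure_coe]
    set M := (LinearMap.range (LinearMap.mulRight ℂ (ιs k))).topologicalClosure with hMd
    have hM : IsClosed (M : Set Cs) := Submodule.isClosed_topologicalClosure _
    let M' : Submodule ℂ Cs :=
      { carrier := {c | star c ∈ M}
        add_mem' := fun {a b} ha hb => by
          change star (a + b) ∈ M
          rw [star_add]; exact add_mem ha hb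
        zero_mem' := by change star 0 ∈ M; rw [star_zero]; exact zero_mem _
        smul_mem' := fun z a ha => by
          change star (z • a) ∈ M
          rw [star_smul]; exact Submodule.smul_mem _ _ ha }
    have hM' : IsClosed (M' : Set Cs) := hM.preimage continuous_star
    have := dense_span_le hds M' hM' (by
      rintro _ ⟨a, c, rfl⟩
      change star (ιs a * c) ∈ M
      rw [star_mul, ← map_star]
      refine map_mem_closure (f := fun x => star c * x) (by fun_prop) (h5 ⟨star a, rfl⟩) ?_
      rintro _ ⟨b, rfl⟩
      exact ⟨star c * ιs b, by simp [mul_assoc]⟩) (star c)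
    have h6 : star (star c) ∈ M := this
    rwa [star_star] at h6
  · have e : (Set.range fun c => F.lsmul c t) =
        (LinearMap.range (F.lorbL t : Cs →ₗ[ℂ] Y) : Set Y) := by
      ext; simp; rfl
    intro y
    rw [e, ← Submodule.topologicalClosure_coe]
    set M := (LinearMap.range (F.lorbL t : Cs →ₗ[ℂ] Y)).topologicalClosure with hMd
    have hM : IsClosed (M : Set Y) := Submodule.isClosed_topologicalClosure _
    have hcx : ∀ c, ∀ x ∈ X, F.lsmul c x ∈ M := by
      intro c x hx
      refine map_mem_closure (F.cont_lsmul c) (h3 hx) ?_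
      rintro _ ⟨b, rfl⟩
      exact ⟨c * ιs b, F.mul_lsmul _ _ _⟩
    refine closure_minimal ?_ hM (F.oneSided_right.mem_closure_act
      (NonUnitalStarAlgHom.id ℂ Cs) Function.injective_id y ⟨_, rfl⟩)
    rintro _ ⟨a, rfl⟩
    exact dense_span_le hX.span_YX_right (M.comap (F.rorbL y : Cs →ₗ[ℂ] Y))
      (hM.preimage (F.cont_rorb y)) (by
        rintro _ ⟨y', x, hx, rfl⟩
        change F.rsmul y (F.rinn y' x) ∈ M
        rw [← F.imprimitivity]
        exact hcx _ x hx) a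

/-- The isometric isomorphism of left Hilbert modules `Cs ≅ Y`. -/
theorem exists_left_iso {A As Cs Y : Type*} [NonUnitalCStarAlgebra A] [NonUnitalCStarAlgebra As]
    [NonUnitalCStarAlgebra Cs] [PartialOrder Cs] [StarOrderedRing Cs]
    [NormedAddCommGroup Y] [NormedSpace ℂ Y] [CompleteSpace Y]
    (F : EquivBimodule Cs Cs Y) (X : Submodule ℂ Y)
    (ιs : As →⋆ₙₐ[ℂ] Cs) (hιs : Function.Injective ιs) (hds : DenseIncl ⇑ιs)
    (hX : IsEquiPair ιs F X)
    {g : ℕ → ℕ → A → Cs} (hg : MatUnits g)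
    (h0 : A) (hsa : star h0 = h0) (hh0 : DenseRange (fun a : A => a * h0))
    (hh0' : DenseRange (fun a : A => h0 * a))
    (hR : Set.range ιs = closure (Submodule.span ℂ {x : Cs | ∃ i j a, x = g i j a} : Set Cs)) :
    ∃ U : Cs ≃ₗᵢ[ℂ] Y, (∀ c x, U (c * x) = F.lsmul c (U x)) ∧
      (∀ x y, F.linn (U x) (U y) = x * star y) ∧ U '' Set.range ιs = X ∧
      ∃ k : As, DenseRange (fun c => c * ιs k) ∧
        Set.range ιs ⊆ closure (Set.range fun a => ιs a * ιs k) := by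
  obtain ⟨t, htX, k, hk1, hk2, h3, h5, h6, h7⟩ :=
    generator_facts F X ιs hιs hds hX hg h0 hsa hh0 hh0' hR
  let f : Cs →ₗ[ℂ] Y := F.lorbL t
  let e : Cs →ₗ[ℂ] Cs := LinearMap.mulRight ℂ (ιs k)
  have hf : ∀ c, f c = F.lsmul c t := fun c => rfl
  have he : ∀ c, e c = c * ιs k := fun c => rfl
  have hinn : ∀ c d, F.linn (f c) (f d) = e c * star (e d) := by
    intro c d
    rw [hf, hf, he, he, F.linn_lsmul_left, F.linn_lsmul_right, ← hk2, star_mul, hk1]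
    simp only [mul_assoc]
  have hn : ∀ c, ‖f c‖ = ‖e c‖ := by
    intro c
    have h := F.norm_linn (f c)
    rw [hinn, CStarRing.norm_self_mul_star, ← sq] at h
    exact ((sq_eq_sq₀ (norm_nonneg _) (norm_nonneg _)).1 h).symm
  have hde : DenseRange e := h6
  have hbd : ∃ K, ∀ x, ‖f x‖ ≤ K * ‖e x‖ := ⟨1, fun x => by rw [hn, one_mul]⟩
  let V : Cs →L[ℂ] Y := f.extendOfNorm e
  have hV : ∀ c, V (c * ιs k) = F.lsmul c t := fun c =>
    LinearMap.extendOfNorm_eq hde hbd c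
  have hVn : ∀ x, ‖V x‖ = ‖x‖ := fun x => by
    refine h6.induction_on (p := fun x => ‖V x‖ = ‖x‖) x
      (isClosed_eq (by fun_prop) (by fun_prop)) ?_
    intro c
    rw [hV]; exact hn c
  have hiso : Isometry V := AddMonoidHomClass.isometry_of_norm V hVn
  have hsurj : Function.Surjective V := by
    have hc : IsClosed (Set.range V) := hiso.isClosedEmbedding.isClosed_range
    intro y
    have : y ∈ closure (Set.range V) := closure_mono (by
      rintro _ ⟨c, rfl⟩; exact ⟨_, hV c⟩) (h7 y)
    rwa [hc.closure_eq] at this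
  let U : Cs ≃ₗᵢ[ℂ] Y := LinearIsometryEquiv.ofSurjective ⟨V.toLinearMap, hVn⟩ hsurj
  have hU : ∀ x, U x = V x := fun x => rfl
  have hUc : Continuous U := U.continuous
  refine ⟨U, ?_, ?_, ?_, k, h6, h5⟩
  · intro c x
    refine h6.induction_on (p := fun x => U (c * x) = F.lsmul c (U x)) x
      (isClosed_eq (by fun_prop) ((F.cont_lsmul c).comp hUc)) ?_
    intro d
    rw [hU, hU, ← mul_assoc, hV, hV, F.mul_lsmul]
  · intro x y
    refine h6.induction_on (p := fun x => F.linn (U x) (U y) = x * star y) x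
      (isClosed_eq ((F.cont_linn_left _).comp hUc) (by fun_prop)) ?_
    intro c
    refine h6.induction_on (p := fun y => F.linn (U (c * ιs k)) (U y) = (c * ιs k) * star y) y
      (isClosed_eq ((F.cont_linn_right _).comp hUc) (by fun_prop)) ?_
    intro d
    rw [hU, hU, hV, hV]
    exact hinn c d
  · apply Set.Subset.antisymm
    · rintro _ ⟨r, hr, rfl⟩
      have := map_mem_closure hUc (h5 hr) (t := (X : Set Y)) (by
        rintro _ ⟨a, rfl⟩
        change U (ιs a * ιs k) ∈ (X : Set Y)
        rw [hU, hV]; exact hX.lsmul_mem a t htX)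
      rwa [hX.closed.closure_eq] at this
    · have hcl : IsClosed (Set.range ιs) := by rw [hR]; exact isClosed_closure
      have hcU : IsClosed (U '' Set.range ιs) := U.toHomeomorph.isClosedMap _ hcl
      refine h3.trans (closure_minimal ?_ hcU)
      rintro _ ⟨a, rfl⟩
      exact ⟨ιs (a * k), ⟨_, rfl⟩, by rw [map_mul, hU]; exact hV _⟩

theorem eq_of_mul_left {C : Type*} [NonUnitalCStarAlgebra C] {d d' : C}
    (h : ∀ x, x * d = x * d') : d = d' := by
  have h1 : star (d - d') * (d - d') = 0 := by rw [mul_sub, h, sub_self]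
  exact sub_eq_zero.mp (CStarRing.star_mul_self_eq_zero_iff _ |>.mp h1)

theorem exists_alpha {Cs Y : Type*}
    [NonUnitalCStarAlgebra Cs] [PartialOrder Cs] [StarOrderedRing Cs]
    [NormedAddCommGroup Y] [NormedSpace ℂ Y] [CompleteSpace Y]
    (F : EquivBimodule Cs Cs Y) (U : Cs ≃ₗᵢ[ℂ] Y)
    (hU1 : ∀ c x, U (c * x) = F.lsmul c (U x))
    (hU2 : ∀ x y, F.linn (U x) (U y) = x * star y)
    (hfull : Dense {c : Cs | ∃ x y, c = star x * y}) :
    ∃ α : Cs ≃⋆ₐ[ℂ] Cs, (∀ x c, F.rsmul (U x) c = U (x * α c)) ∧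
      ∀ x y, F.rinn (U x) (U y) = α.symm (star x * y) := by
  let P : Submodule ℂ (Cs × Cs) :=
    { carrier := {p | ∀ x, F.rsmul (U x) p.1 = U (x * p.2)}
      add_mem' := by
        intro p q hp hq x
        simp only [Prod.fst_add, Prod.snd_add, F.rsmul_add, mul_add, map_add, hp x, hq x]
      zero_mem' := by
        intro x
        have : F.rsmul (U x) 0 = 0 := by
          have := F.smul_rsmul 0 (U x) 0
          simpa using this
        simp [this]
      smul_mem' := by
        intro z p hp x
        simp only [Prod.smul_fst, Prod.smul_snd, F.smul_rsmul, mul_smul_comm, map_smul, hp x] }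
  have hPmem : ∀ p, p ∈ P ↔ ∀ x, F.rsmul (U x) p.1 = U (x * p.2) := fun p => Iff.rfl
  have hPrinn : ∀ x y, (F.rinn (U x) (U y), star x * y) ∈ P := by
    intro x y z
    change F.rsmul (U z) (F.rinn (U x) (U y)) = U (z * (star x * y))
    rw [← F.imprimitivity, hU2, ← hU1, mul_assoc]
  have hPn : ∀ p ∈ P, ‖p.2‖ ≤ ‖p.1‖ := by
    intro p hp
    have h1 : ‖p.2‖ * ‖p.2‖ ≤ ‖p.1‖ * ‖p.2‖ := by
      rw [← CStarRing.norm_star_mul_self (x := p.2), ← U.norm_map, ← hp (star p.2)]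
      refine (F.norm_rsmul_le _ _).trans ?_
      rw [U.norm_map, norm_star]
    rcases (norm_nonneg p.2).eq_or_lt with h | h
    · rw [← h]; exact norm_nonneg _
    · exact le_of_mul_le_mul_right h1 h
  have hPc : IsClosed (P : Set (Cs × Cs)) := by
    have : (P : Set (Cs × Cs)) = ⋂ x, {p | F.rsmul (U x) p.1 = U (x * p.2)} := by
      ext p; simp [hPmem]
    rw [this]
    refine isClosed_iInter fun x => isClosed_eq ?_ ?_
    · exact (F.cont_rorb (U x)).comp continuous_fst
    · exact U.continuous.comp (continuous_const.mul continuous_snd)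
  have hex : ∀ c, ∃ d, (c, d) ∈ P := by
    let q : P →L[ℂ] Cs := (ContinuousLinearMap.fst ℂ Cs Cs).comp P.subtypeL
    have hq : AntilipschitzWith 1 q := by
      refine ContinuousLinearMap.antilipschitz_of_bound q (K := 1) ?_
      rintro ⟨p, hp⟩
      have := hPn p hp
      change ‖p‖ ≤ ((1 : NNReal) : ℝ) * ‖p.1‖
      rw [Prod.norm_def, NNReal.coe_one, one_mul]
      exact max_le le_rfl this
    have : CompleteSpace P := hPc.completeSpace_coe
    have hcl : IsClosed (Set.range q) := hq.isClosed_range q.uniformContinuous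
    let R : Submodule ℂ Cs := LinearMap.range (q : P →ₗ[ℂ] Cs)
    have hR : (R : Set Cs) = Set.range q := rfl
    intro c
    have hc : c ∈ R := by
      refine dense_span_le F.full_right R (by rw [hR]; exact hcl) ?_ c
      rintro d ⟨x, y, rfl⟩
      obtain ⟨x, rfl⟩ := U.surjective x
      obtain ⟨y, rfl⟩ := U.surjective y
      exact ⟨⟨_, hPrinn x y⟩, rfl⟩
    obtain ⟨⟨⟨c', d⟩, hp⟩, h⟩ := hc
    have : c' = c := h
    subst this
    exact ⟨d, hp⟩
  choose a ha using hex
  have ha' : ∀ c x, F.rsmul (U x) c = U (x * a c) := fun c x => ha c x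
  have hu : ∀ c d, (c, d) ∈ P → a c = d := by
    intro c d h
    refine eq_of_mul_left fun x => U.injective ?_
    rw [← ha' c x, h x]
  have hstar : ∀ c, a (star c) = star (a c) := by
    intro c
    refine eq_of_mul_left fun x => ?_
    have h1 : ∀ y, (x * a (star c)) * star y = (x * star (a c)) * star y := by
      intro y
      rw [← hU2, ← ha', F.linn_rsmul, star_star, ha', hU2, star_mul, mul_assoc]
    refine star_injective (eq_of_mul_left fun y => star_injective ?_)
    simpa using h1 y
  let φ : Cs →⋆ₙₐ[ℂ] Cs :=
    { toFun := a
      map_smul' := fun z c => hu _ _ (P.smul_mem z (ha c))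
      map_zero' := hu _ _ P.zero_mem
      map_add' := fun c d => hu _ _ (P.add_mem (ha c) (ha d))
      map_mul' := fun c d => hu _ _ (by
        intro x
        change F.rsmul (U x) (c * d) = U (x * (a c * a d))
        rw [F.rsmul_mul, ha', ha', mul_assoc])
      map_star' := hstar }
  have hφ : ∀ c, φ c = a c := fun c => rfl
  have hinj : Function.Injective φ := by
    rw [injective_iff_map_eq_zero]
    intro c hc
    refine F.right_faithful c fun y => ?_
    obtain ⟨x, rfl⟩ := U.surjective y
    rw [ha', ← hφ, hc, mul_zero, map_zero]
  have hiso : Isometry φ := NonUnitalStarAlgHom.isometry φ hinj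
  have hrinn : ∀ x y, φ (F.rinn (U x) (U y)) = star x * y := fun x y => hu _ _ (hPrinn x y)
  have hsurj : Function.Surjective φ := by
    have hcl : IsClosed (Set.range φ) := hiso.isClosedEmbedding.isClosed_range
    intro d
    have : d ∈ closure (Set.range φ) := by
      refine closure_mono ?_ (hfull d)
      rintro _ ⟨x, y, rfl⟩
      exact ⟨_, hrinn x y⟩
    rwa [hcl.closure_eq] at this
  let α : Cs ≃⋆ₐ[ℂ] Cs := StarAlgEquiv.ofBijective φ ⟨hinj, hsurj⟩
  have hα : ∀ c, α c = φ c := fun c => rfl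
  refine ⟨α, fun x c => ha' c x, fun x y => ?_⟩
  rw [← hrinn, ← hα]
  exact (α.symm_apply_apply _).symm

theorem star_alg_equiv_norm {Cs : Type*} [NonUnitalCStarAlgebra Cs] (α : Cs ≃⋆ₐ[ℂ] Cs) (x : Cs) :
    ‖α x‖ = ‖x‖ := by
  exact NonUnitalStarAlgHom.norm_map α α.injective x

theorem full_of_products {Cs : Type*} [NonUnitalCStarAlgebra Cs] (b : Cs) :
    b ∈ closure {c : Cs | ∃ x y, c = star x * y} := by
  rw [Metric.mem_closure_iff]
  intro ε hε
  obtain ⟨a, -, ha⟩ := exists_approx_unit b ε hε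
  exact ⟨b * a, ⟨star b, a, by simp⟩, by rwa [dist_eq_norm]⟩

def alphaBimodule {Cs : Type*} [NonUnitalCStarAlgebra Cs] [PartialOrder Cs] [StarOrderedRing Cs]
    (α : Cs ≃⋆ₐ[ℂ] Cs) : EquivBimodule Cs Cs Cs where
  lsmul := fun c x => c * x
  rsmul := fun x c => x * α c
  linn := fun x y => x * star y
  rinn := fun x y => α.symm (star x * y)
  lsmul_add := fun c x y => mul_add c x y
  add_lsmul := fun c c' x => add_mul c c' x
  mul_lsmul := fun c c' x => mul_assoc c c' x
  smul_lsmul := fun z c x => smul_mul_assoc z c x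
  lsmul_smul := fun z c x => mul_smul_comm z c x
  add_rsmul := fun x y d => add_mul x y _
  rsmul_add := fun x d d' => by rw [map_add, mul_add]
  rsmul_mul := fun x d d' => by rw [map_mul, mul_assoc]
  rsmul_smul := fun z x d => smul_mul_assoc z x _
  smul_rsmul := fun z x d => by rw [map_smul, mul_smul_comm]
  lsmul_rsmul := fun c x d => mul_assoc c x _
  linn_add_left := fun x y z => add_mul x y _
  linn_smul_left := fun t x y => smul_mul_assoc t x _
  linn_star := fun x y => by simp
  linn_lsmul_left := fun c x y => mul_assoc c x _
  linn_nonneg := fun x => mul_star_self_nonneg x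
  linn_definite := fun x h => (CStarRing.mul_star_self_eq_zero_iff x).mp h
  rinn_add_right := fun x y z => by rw [mul_add, map_add]
  rinn_smul_right := fun t x y => by rw [mul_smul_comm, map_smul]
  rinn_star := fun x y => by rw [← map_star, star_mul, star_star]
  rinn_rsmul_right := fun x y d => by
    rw [← mul_assoc, map_mul, α.symm_apply_apply]
  rinn_nonneg := fun x => by
    rw [map_mul, map_star]; exact star_mul_self_nonneg _
  rinn_definite := fun x h => by
    rw [EmbeddingLike.map_eq_zero_iff] at h
    exact (CStarRing.star_mul_self_eq_zero_iff x).mp h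
  imprimitivity := fun x y z => by rw [α.apply_symm_apply, mul_assoc]
  norm_linn := fun x => by rw [CStarRing.norm_self_mul_star, sq]
  norm_rinn := fun x => by rw [star_alg_equiv_norm, CStarRing.norm_star_mul_self, sq]
  full_left := fun b => by
    refine closure_mono ?_ (full_of_products b)
    rintro _ ⟨x, y, rfl⟩
    exact Submodule.subset_span ⟨star x, star y, by rw [star_star]⟩
  full_right := fun b => by
    have hc : Continuous α.symm :=
      (AddMonoidHomClass.isometry_of_norm α.symm (star_alg_equiv_norm α.symm)).continuous
    have := map_mem_closure (t := (Submodule.span ℂ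
      {d : Cs | ∃ x y, d = α.symm (star x * y)} : Set Cs)) hc (full_of_products (α b)) (by
        rintro _ ⟨x, y, rfl⟩
        exact Submodule.subset_span ⟨x, y, rfl⟩)
    rwa [α.symm_apply_apply] at this

theorem coe_rangeSub {As Cs : Type*} [NonUnitalCStarAlgebra As] [NonUnitalCStarAlgebra Cs]
    (ιs : As →⋆ₙₐ[ℂ] Cs) : (rangeSub ⇑ιs : Set Cs) = Set.range ιs := by
  have : Set.range ιs = (LinearMap.range (ιs : As →ₗ[ℂ] Cs) : Set Cs) := rfl
  unfold rangeSub
  rw [this, Submodule.span_eq]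

theorem surj_part {A As Cs Y : Type*} [NonUnitalCStarAlgebra A] [NonUnitalCStarAlgebra As]
    [NonUnitalCStarAlgebra Cs] [PartialOrder Cs] [StarOrderedRing Cs]
    [NormedAddCommGroup Y] [NormedSpace ℂ Y] [CompleteSpace Y]
    (F : EquivBimodule Cs Cs Y) (X : Submodule ℂ Y)
    (ιs : As →⋆ₙₐ[ℂ] Cs) (hιs : Function.Injective ιs) (hds : DenseIncl ⇑ιs)
    (hX : IsEquiPair ιs F X)
    {g : ℕ → ℕ → A → Cs} (hg : MatUnits g)
    (h0 : A) (hsa : star h0 = h0) (hh0 : DenseRange (fun a : A => a * h0))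
    (hh0' : DenseRange (fun a : A => h0 * a))
    (hR : Set.range ιs = closure (Submodule.span ℂ {x : Cs | ∃ i j a, x = g i j a} : Set Cs)) :
    ∃ (α : Cs ≃⋆ₐ[ℂ] Cs), ⇑α '' Set.range ⇑ιs = Set.range ⇑ιs ∧
          ∃ (Eα : EquivBimodule Cs Cs Cs), IsAlphaData ⇑α ⇑α.symm Eα ∧
            PairEquiv Eα (rangeSub ⇑ιs) F X := by
  obtain ⟨U, hU1, hU2, hU3, k, hk1, hk2⟩ :=
    exists_left_iso F X ιs hιs hds hX hg h0 hsa hh0 hh0' hR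
  obtain ⟨α, hα1, hα2⟩ := exists_alpha F U hU1 hU2 full_of_products
  have hαi : Isometry α := AddMonoidHomClass.isometry_of_norm α (star_alg_equiv_norm α)
  have hcl : IsClosed (Set.range ιs) := by rw [hR]; exact isClosed_closure
  have hUX : ∀ a, U (ιs a) ∈ X := fun a => by
    change U (ιs a) ∈ (X : Set Y)
    rw [← hU3]; exact ⟨_, ⟨a, rfl⟩, rfl⟩
  have hα3 : ∀ x y, α (F.rinn (U x) (U y)) = star x * y := fun x y => by
    rw [hα2, α.apply_symm_apply]
  have hXU : ∀ x ∈ X, ∃ a, U (ιs a) = x := by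
    intro x hx
    have : x ∈ (X : Set Y) := hx
    rw [← hU3] at this
    obtain ⟨_, ⟨a, rfl⟩, h⟩ := this
    exact ⟨a, h⟩
  refine ⟨α, Set.Subset.antisymm ?_ ?_, alphaBimodule α, ⟨rfl, rfl, rfl, rfl⟩,
    ⟨⟨U.toLinearEquiv, ?_, ?_, ?_, ?_⟩, ?_⟩⟩
  · rintro _ ⟨c, hc, rfl⟩
    rw [← hX.span_XX_right] at hc
    rw [← hcl.closure_eq]
    refine map_mem_closure hαi.continuous hc ?_
    intro d hd
    rw [← coe_rangeSub]
    change d ∈ (rangeSub ⇑ιs).comap (α : Cs →ₗ[ℂ] Cs)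
    refine Submodule.span_le.mpr ?_ hd
    rintro _ ⟨x, hx, y, hy, rfl⟩
    obtain ⟨a, rfl⟩ := hXU x hx
    obtain ⟨b, rfl⟩ := hXU y hy
    change α _ ∈ (rangeSub ⇑ιs : Set Cs)
    rw [coe_rangeSub, hα3]
    exact ⟨star a * b, by rw [map_mul, map_star]⟩
  · have hcl2 : IsClosed (α '' Set.range ιs) :=
      hαi.isClosedEmbedding.isClosedMap _ hcl
    refine hk2.trans (closure_minimal ?_ hcl2)
    rintro _ ⟨a, rfl⟩
    refine ⟨F.rinn (U (ιs (star a))) (U (ιs k)), hX.rinn_mem _ (hUX _) _ (hUX _), ?_⟩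
    rw [hα3, map_star, star_star]
  · intro c y; exact hU1 c y
  · intro y d; exact (hα1 y d).symm
  · intro x y; exact hU2 x y
  · intro x y; exact hα2 x y
  · apply SetLike.coe_injective
    rw [Submodule.map_coe, coe_rangeSub, ← hU3]
    rfl

section KernelPart

variable {C : Type*} [NonUnitalCStarAlgebra C]

theorem eq_of_mul_right {d d' : C} (h : ∀ x, d * x = d' * x) : d = d' := by
  refine star_injective (eq_of_mul_left fun x => star_injective ?_)
  simpa using h (star x)

theorem mult_snd_mul (u : 𝓜(ℂ, C)) (c x : C) : u.snd (c * x) = c * u.snd x := by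
  refine eq_of_mul_right fun y => ?_
  rw [u.central, mul_assoc, mul_assoc, u.central]

theorem mult_fst_mul (u : 𝓜(ℂ, C)) (x c : C) : u.fst (x * c) = u.fst x * c := by
  refine eq_of_mul_left fun y => ?_
  rw [← u.central, ← mul_assoc, ← mul_assoc, u.central]

theorem mult_snd_fst (u : 𝓜(ℂ, C)) (d : C) : u.snd (u.fst d) = u.fst (u.snd d) := by
  refine eq_of_mul_left fun x => eq_of_mul_right fun y => ?_
  rw [← mult_snd_mul, u.central, ← u.central x, mul_assoc (u.snd x), ← u.central d, ← mul_assoc,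
    u.central x]

theorem kernel_backward {As : Type*} [NonUnitalCStarAlgebra As] [PartialOrder C]
    [StarOrderedRing C] (ιs : As →⋆ₙₐ[ℂ] C) (α : C ≃⋆ₐ[ℂ] C)
    (E : EquivBimodule C C C) (hE : IsAlphaData ⇑α ⇑α.symm E)
    (T : EquivBimodule C C C) (hT : IsTrivialData T)
    (u : 𝓜(ℂ, C)) (hu : u ∈ unitary 𝓜(ℂ, C)) (hm : IsMultiplierOf ⇑ιs u)
    (hα : ∀ c, α c = mAd u c) :
    PairEquiv E (rangeSub ⇑ιs) T (rangeSub ⇑ιs) := by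
  obtain ⟨hE1, hE2, hE3, hE4⟩ := hE
  obtain ⟨hT1, hT2, hT3, hT4⟩ := hT
  have hu1 : star u * u = 1 := (Unitary.mem_iff.mp hu).1
  have hu2 : u * star u = 1 := (Unitary.mem_iff.mp hu).2
  have s1 : ∀ x, u.snd ((star u).snd x) = x := by
    intro x
    have := congrArg (fun v : 𝓜(ℂ, C) => v.snd x) hu1
    simp only [DoubleCentralizer.mul_snd, DoubleCentralizer.one_snd] at this
    exact this
  have s2 : ∀ x, (star u).snd (u.snd x) = x := by
    intro x
    have := congrArg (fun v : 𝓜(ℂ, C) => v.snd x) hu2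
    simp only [DoubleCentralizer.mul_snd, DoubleCentralizer.one_snd] at this
    exact this
  have s3 : ∀ x, u.fst (star (u.snd x)) = star x := by
    intro x
    have := s2 x
    rw [DoubleCentralizer.star_snd] at this
    rw [← this, star_star, this]
  have hr : ∀ x c, u.snd (x * α c) = u.snd x * c := by
    intro x c
    rw [hα, mAd, mult_snd_mul, mult_snd_fst, s1, u.central]
  have hri : ∀ x y, star (u.snd x) * u.snd y = α.symm (star x * y) := by
    intro x y
    refine (EquivLike.injective α) ?_
    rw [α.apply_symm_apply, hα, mAd, mult_snd_mul, s2, mult_fst_mul, s3]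
  let Φ : C ≃ₗ[ℂ] C :=
    LinearEquiv.ofLinearMap (u.snd : C →ₗ[ℂ] C) ((star u).snd : C →ₗ[ℂ] C)
      (LinearMap.ext s1) (LinearMap.ext s2)
  have hΦ : ∀ x, Φ x = u.snd x := fun x => rfl
  refine ⟨⟨Φ, ?_, ?_, ?_, ?_⟩, ?_⟩
  · intro c y; simp only [hE1, hT1, hΦ]; exact mult_snd_mul u c y
  · intro y d; simp only [hE2, hT2, hΦ]; exact hr y d
  · intro x y; simp only [hE3, hT3, hΦ]; rw [u.central, s3]
  · intro x y; simp only [hE4, hT4, hΦ]; exact hri x y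
  · apply SetLike.coe_injective
    rw [Submodule.map_coe, coe_rangeSub]
    apply Set.Subset.antisymm
    · rintro _ ⟨_, ⟨a, rfl⟩, rfl⟩
      exact hm.2 a
    · rintro _ ⟨a, rfl⟩
      refine ⟨(star u).snd (ιs a), ?_, s1 _⟩
      rw [DoubleCentralizer.star_snd, ← map_star ιs]
      obtain ⟨b, hb⟩ := hm.1 (star a)
      exact ⟨star b, by rw [map_star, hb]⟩

theorem kernel_forward {As : Type*} [NonUnitalCStarAlgebra As] [PartialOrder C]
    [StarOrderedRing C] (ιs : As →⋆ₙₐ[ℂ] C) (α : C ≃⋆ₐ[ℂ] C)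
    (hα : ⇑α '' Set.range ⇑ιs = Set.range ⇑ιs)
    (E : EquivBimodule C C C) (hE : IsAlphaData ⇑α ⇑α.symm E)
    (T : EquivBimodule C C C) (hT : IsTrivialData T)
    (h : PairEquiv E (rangeSub ⇑ιs) T (rangeSub ⇑ιs)) :
    ∃ u : 𝓜(ℂ, C), u ∈ unitary 𝓜(ℂ, C) ∧ IsMultiplierOf ⇑ιs u ∧ ∀ c : C, α c = mAd u c := by
  obtain ⟨hE1, hE2, hE3, hE4⟩ := hE
  obtain ⟨hT1, hT2, hT3, hT4⟩ := hT
  obtain ⟨⟨Φ, m1, m2, m3, m4⟩, hΦ⟩ := h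
  simp only [hE1, hE2, hE3, hT1, hT2, hT3] at m1 m2 m3
  have hΦr : ∀ c ∈ Set.range ιs, Φ c ∈ Set.range ιs := by
    intro c hc
    have h1 := congrArg (fun S : Submodule ℂ C => (S : Set C)) hΦ
    simp only [Submodule.map_coe, coe_rangeSub] at h1
    rw [← h1]
    exact ⟨c, hc, rfl⟩
  have hαr : ∀ a, α (ιs a) ∈ Set.range ιs := fun a => by
    rw [← hα]; exact ⟨_, ⟨a, rfl⟩, rfl⟩
  have hn : ∀ x, ‖Φ x‖ = ‖x‖ := by
    intro x
    have h1 := m3 x x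
    have h2 : ‖Φ x‖ * ‖Φ x‖ = ‖x‖ * ‖x‖ := by
      rw [← CStarRing.norm_self_mul_star, h1, CStarRing.norm_self_mul_star]
    exact (mul_self_inj (norm_nonneg _) (norm_nonneg _)).mp h2
  have K1 : ∀ y, Φ (α (star (Φ y))) = star y := by
    intro y
    refine eq_of_mul_left fun x => ?_
    rw [← m1, m2, m3]
  have K2 : ∀ z, Φ (star (Φ (α z))) = star z := by
    intro z
    obtain ⟨y, hy⟩ := Φ.surjective (star z)
    have hz : z = star (Φ y) := by rw [hy, star_star]
    rw [hz, K1, star_star, star_star]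
  let S : C →L[ℂ] C := LinearMap.mkContinuous (Φ : C →ₗ[ℂ] C) 1
    (fun x => by rw [one_mul]; exact (hn x).le)
  let Q : C →L[ℂ] C := LinearMap.mkContinuous ((Φ : C →ₗ[ℂ] C) ∘ₗ (α : C →ₗ[ℂ] C)) 1
    (fun x => by rw [one_mul]; exact ((hn _).trans (star_alg_equiv_norm α x)).le)
  let u : 𝓜(ℂ, C) :=
    { fst := Q
      snd := S
      central := fun x y => by
        change Φ x * y = x * Φ (α y)
        rw [← m1, m2] }
  have hus : ∀ x, u.snd x = Φ x := fun x => rfl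
  have huf : ∀ x, u.fst x = Φ (α x) := fun x => rfl
  refine ⟨u, ?_, ⟨fun a => ?_, fun a => ?_⟩, fun c => ?_⟩
  · rw [Unitary.mem_iff]
    constructor
    · apply DoubleCentralizer.ext
      apply Prod.ext
      · apply ContinuousLinearMap.ext
        intro x
        change (star u).fst (u.fst x) = x
        rw [DoubleCentralizer.star_fst, hus, huf, K2, star_star]
      · apply ContinuousLinearMap.ext
        intro x
        change u.snd ((star u).snd x) = x
        rw [DoubleCentralizer.star_snd, hus, huf, K2, star_star]
    · apply DoubleCentralizer.ext
      apply Prod.ext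
      · apply ContinuousLinearMap.ext
        intro x
        change u.fst ((star u).fst x) = x
        rw [DoubleCentralizer.star_fst, hus, huf, K1, star_star]
      · apply ContinuousLinearMap.ext
        intro x
        change (star u).snd (u.snd x) = x
        rw [DoubleCentralizer.star_snd, hus, huf, K1, star_star]
  · exact hΦr _ (hαr a)
  · exact hΦr _ ⟨a, rfl⟩
  · rw [mAd, DoubleCentralizer.star_snd, huf, huf, K1, map_star, star_star]

end KernelPart

/-- For an inclusion `A ⊆ C` with `A` σ-unital and `AC` dense in `C`, and
the induced stabilized inclusion `A^s = A ⊗ K ⊆ C^s = C ⊗ K`, the sequence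
`1 → Int(A^s, C^s) → Aut(A^s, C^s) → Pic(A^s, C^s) → 1` is exact: the natural
homomorphism `π(α) = [X_α, Y_α]` is surjective and its kernel is `Int(A^s, C^s)`. -/
theorem stabilized_Pic_exact
    {A C As Cs : Type*}
    [NonUnitalCStarAlgebra A] [PartialOrder A] [StarOrderedRing A]
    [NonUnitalCStarAlgebra C] [PartialOrder C] [StarOrderedRing C]
    [NonUnitalCStarAlgebra As]
    [NonUnitalCStarAlgebra Cs] [PartialOrder Cs] [StarOrderedRing Cs]
    (ι : A →⋆ₙₐ[ℂ] C) (hι : Function.Injective ι) (hd : DenseIncl ⇑ι)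
    (hσ : SigmaUnital A)
    (e : ℕ → ℕ → C → Cs) (hstab : IsStabilization e)
    (ιs : As →⋆ₙₐ[ℂ] Cs) (hιs : Function.Injective ιs) (hds : DenseIncl ⇑ιs)
    (hAs : Set.range ⇑ιs =
      closure (Submodule.span ℂ {x : Cs | ∃ i j a, x = e i j (ι a)} : Set Cs)) :
    -- exactness at `Aut(A^s, C^s)` : `π(α) = [A^s, C^s]` iff `α ∈ Int(A^s, C^s)`
    (∀ (α : Cs ≃⋆ₐ[ℂ] Cs), ⇑α '' Set.range ⇑ιs = Set.range ⇑ιs →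
      ∀ (Eα : EquivBimodule Cs Cs Cs), IsAlphaData ⇑α ⇑α.symm Eα →
      ∀ (T : EquivBimodule Cs Cs Cs), IsTrivialData T →
        (PairEquiv Eα (rangeSub ⇑ιs) T (rangeSub ⇑ιs) ↔
          ∃ u : 𝓜(ℂ, Cs), u ∈ unitary 𝓜(ℂ, Cs) ∧ IsMultiplierOf ⇑ιs u ∧
            ∀ c : Cs, α c = mAd u c)) ∧
    -- surjectivity of `π : Aut(A^s, C^s) → Pic(A^s, C^s)`
    (∀ (Yt : Type*) [NormedAddCommGroup Yt] [NormedSpace ℂ Yt] [CompleteSpace Yt]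
      (F : EquivBimodule Cs Cs Yt) (X : Submodule ℂ Yt), IsEquiPair ⇑ιs F X →
        ∃ (α : Cs ≃⋆ₐ[ℂ] Cs), ⇑α '' Set.range ⇑ιs = Set.range ⇑ιs ∧
          ∃ (Eα : EquivBimodule Cs Cs Cs), IsAlphaData ⇑α ⇑α.symm Eα ∧
            PairEquiv Eα (rangeSub ⇑ιs) F X) := by
  refine ⟨?_, ?_⟩
  · intro α hα Eα hEα T hT
    refine ⟨kernel_forward ιs α hα Eα hEα T hT, ?_⟩
    rintro ⟨u, hu, hm, hc⟩
    exact kernel_backward ιs α Eα hEα T hT u hu hm hc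
  · intro Yt _ _ _ F X hX
    obtain ⟨h0, hpos, hdense⟩ := hσ
    have hsa : star h0 = h0 := (IsSelfAdjoint.of_nonneg hpos).star_eq
    have hιc : Continuous ι := (NonUnitalStarAlgHom.isometry ι hι).continuous
    have hec : ∀ i j, Continuous (e i j) := by
      intro i j
      let f : C →+ Cs := AddMonoidHom.mk' (e i j) (hstab.map_add i j)
      exact (AddMonoidHomClass.isometry_of_norm f (hstab.isometry i j)).continuous
    have hg : MatUnits (fun i j a => e i j (ι a)) :=
      { cont := fun i j => (hec i j).comp hιc
        mul := fun i j k l a b => by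
          simp only [hstab.map_mul, map_mul]
        map_star := fun i j a => by
          simp only [hstab.map_star, map_star] }
    have hdense' : DenseRange (fun a : A => a * h0) := by
      have h1 : DenseRange (fun a : A => star (h0 * star a)) :=
        (star_involutive.surjective.denseRange.comp (hdense : DenseRange fun a : A => h0 * a)
          continuous_star).comp star_involutive.surjective.denseRange
            (continuous_star.comp (continuous_const.mul continuous_id))
      simpa only [star_mul, star_star, hsa] using h1
    exact surj_part F X ιs hιs hds hX hg h0 hsa hdense' hdense hAs

end
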